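/- arXiv:2406.16493 — 12 statements merged into one kernel-verified Lean document; each statement's English description precedes it below -/
import Mathlib

section
/- Let r > 0, ρ > 0 and let γ > 1 satisfy γ² − γ − 2r/ρ² = 0. Then both functions π ↦ (1−π)·(π/(1−π))^γ and π ↦ (1−π)·(π/(1−π))^{1−γ} are twice continuously differentiable on (0,1) and solve the ordinary differential equation (ρ²/2)·π²(1−π)²·v''(π) − r·v(π) = 0 for all π ∈ (0,1). -/
open Set

theorem hasDerivAt_odds_rpow (a : ℝ) {x : ℝ} (hx : x ∈ Ioo (0 : ℝ) 1) :
    HasDerivAt (fun y : ℝ => (y / (1 - y)) ^ a) ((x / (1 - x)) ^ a * (a / (x * (1 - x)))) x := by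
  have h0 : x ≠ 0 := hx.1.ne'
  have h1 : 1 - x ≠ 0 := (sub_pos.2 hx.2).ne'
  have hz : x / (1 - x) ≠ 0 := div_ne_zero h0 h1
  have hd : HasDerivAt (fun y : ℝ => y / (1 - y)) (1 / (1 - x) ^ 2) x := by
    refine ((hasDerivAt_id' x).div ((hasDerivAt_id' x).const_sub 1) h1).congr_deriv ?_
    ring
  refine (hd.rpow_const (p := a) (Or.inl hz)).congr_deriv ?_
  rw [Real.rpow_sub_one hz]
  field_simp

theorem hasDerivAt_one_sub_mul_odds_rpow (a : ℝ) {x : ℝ} (hx : x ∈ Ioo (0 : ℝ) 1) :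
    HasDerivAt (fun y : ℝ => (1 - y) * (y / (1 - y)) ^ a)
      ((x / (1 - x)) ^ a * (a / x - 1)) x := by
  have h0 : x ≠ 0 := hx.1.ne'
  have h1 : 1 - x ≠ 0 := (sub_pos.2 hx.2).ne'
  refine (((hasDerivAt_id' x).const_sub 1).mul (hasDerivAt_odds_rpow a hx)).congr_deriv ?_
  field_simp
  ring

theorem deriv_deriv_one_sub_mul_odds_rpow (a : ℝ) {x : ℝ} (hx : x ∈ Ioo (0 : ℝ) 1) :
    deriv (deriv fun y : ℝ => (1 - y) * (y / (1 - y)) ^ a) x =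
      (x / (1 - x)) ^ a * (a * (a - 1) / (x ^ 2 * (1 - x))) := by
  have h0 : x ≠ 0 := hx.1.ne'
  have h1 : 1 - x ≠ 0 := (sub_pos.2 hx.2).ne'
  have heq : (deriv fun y : ℝ => (1 - y) * (y / (1 - y)) ^ a) =ᶠ[nhds x]
      fun y => (y / (1 - y)) ^ a * (a / y - 1) := by
    filter_upwards [isOpen_Ioo.mem_nhds hx] with y hy
    exact (hasDerivAt_one_sub_mul_odds_rpow a hy).deriv
  have hq : HasDerivAt (fun y : ℝ => a / y - 1) (-a / x ^ 2) x := by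
    refine (((hasDerivAt_const x a).div (hasDerivAt_id' x) h0).sub_const 1).congr_deriv ?_
    ring
  rw [heq.deriv_eq]
  refine ((hasDerivAt_odds_rpow a hx).mul hq).deriv.trans ?_
  field_simp
  ring

theorem contDiffOn_one_sub_mul_odds_rpow (a : ℝ) {n : WithTop ℕ∞} :
    ContDiffOn ℝ n (fun y : ℝ => (1 - y) * (y / (1 - y)) ^ a) (Ioo 0 1) := by
  have h : ContDiffOn ℝ n (fun y : ℝ => 1 - y) (Ioo 0 1) := by fun_prop
  exact h.mul <| (contDiffOn_id.div h fun y hy => (sub_pos.2 hy.2).ne').rpow_const_of_ne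
    fun y hy => (div_pos hy.1 (sub_pos.2 hy.2)).ne'

theorem one_sub_mul_odds_rpow_solves {r ρ a : ℝ} (ha : ρ ^ 2 / 2 * (a * (a - 1)) = r)
    {x : ℝ} (hx : x ∈ Ioo (0 : ℝ) 1) :
    ρ ^ 2 / 2 * (x ^ 2 * (1 - x) ^ 2) *
        deriv (deriv fun y : ℝ => (1 - y) * (y / (1 - y)) ^ a) x -
      r * ((1 - x) * (x / (1 - x)) ^ a) = 0 := by
  have h0 : x ≠ 0 := hx.1.ne'
  have h1 : 1 - x ≠ 0 := (sub_pos.2 hx.2).ne'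
  rw [deriv_deriv_one_sub_mul_odds_rpow a hx, ← ha]
  field_simp
  ring

/-- For `γ > 1` the root of `γ² − γ − 2r/ρ² = 0`, the functions
`π ↦ (1−π)(π/(1−π))^γ` and `π ↦ (1−π)(π/(1−π))^{1−γ}` are twice continuously
differentiable on `(0,1)` and solve `(ρ²/2)π²(1−π)² v'' − r v = 0` there. -/
theorem statement1
    (r ρ γ : ℝ) (hr : 0 < r) (hρ : 0 < ρ) (hγ : 1 < γ)
    (hquad : γ ^ 2 - γ - 2 * r / ρ ^ 2 = 0)
    (v₁ v₂ : ℝ → ℝ)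
    (hv₁ : ∀ π : ℝ, v₁ π = (1 - π) * (π / (1 - π)) ^ γ)
    (hv₂ : ∀ π : ℝ, v₂ π = (1 - π) * (π / (1 - π)) ^ (1 - γ)) :
    ContDiffOn ℝ 2 v₁ (Ioo 0 1) ∧
    ContDiffOn ℝ 2 v₂ (Ioo 0 1) ∧
    (∀ π ∈ Ioo (0 : ℝ) 1,
      ρ ^ 2 / 2 * (π ^ 2 * (1 - π) ^ 2) * deriv (deriv v₁) π - r * v₁ π = 0) ∧
    (∀ π ∈ Ioo (0 : ℝ) 1,
      ρ ^ 2 / 2 * (π ^ 2 * (1 - π) ^ 2) * deriv (deriv v₂) π - r * v₂ π = 0) := by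
  obtain rfl := funext hv₁
  obtain rfl := funext hv₂
  have ha : ρ ^ 2 / 2 * (γ * (γ - 1)) = r := by
    field_simp at hquad
    linarith
  have hb : ρ ^ 2 / 2 * ((1 - γ) * (1 - γ - 1)) = r := by linarith
  exact ⟨contDiffOn_one_sub_mul_odds_rpow γ, contDiffOn_one_sub_mul_odds_rpow (1 - γ),
    fun _ hx => one_sub_mul_odds_rpow_solves ha hx,
    fun _ hx => one_sub_mul_odds_rpow_solves hb hx⟩
end

section
/- Fix k ∈ (0,1) and let γ : [0,1] → ℝ be twice continuously differentiable with γ(u) > 1 and γ'(u) < 0 for all u ∈ [0,1]. Define c(u) := kγ(u)/(k + γ(u) − 1) and F(u,b) := ([2(b−k)γ'(u)² + (γ(u)k − (γ(u)+k−1)b)γ''(u)] / [−γ(u)(γ(u)k − (γ(u)+k−1)b) − (γ(u)−1)(1−k)b]) · b(1−b)/γ'(u). Then for every u ∈ [0,1]: (i) k < c(u) < 1; (ii) c'(u) = −k(1−k)γ'(u)/(γ(u)+k−1)², so in particular c'(u) > 0; and (iii) F(u, c(u)) = 2c'(u) > c'(u) > 0. -/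
open Set

/-- Properties of the constant-learning-rate stopping boundary
`c(u) = kγ(u)/(k+γ(u)−1)`: `k < c(u) < 1`, the formula for `c'(u)`, its
positivity, and `F(u,c(u)) = 2c'(u) > c'(u) > 0`. -/
theorem statement3
    (k : ℝ) (hk : k ∈ Ioo (0 : ℝ) 1)
    (γ : ℝ → ℝ) (hγC : ContDiffOn ℝ 2 γ (Icc 0 1))
    (hγ : ∀ u ∈ Icc (0 : ℝ) 1, 1 < γ u)
    (hγ' : ∀ u ∈ Icc (0 : ℝ) 1, deriv γ u < 0)
    (c : ℝ → ℝ) (hc : ∀ u, c u = k * γ u / (k + γ u - 1))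
    (F : ℝ → ℝ → ℝ)
    (hF : ∀ u b, F u b =
      (2 * (b - k) * (deriv γ u) ^ 2
          + (γ u * k - (γ u + k - 1) * b) * deriv (deriv γ) u) /
        (-(γ u) * (γ u * k - (γ u + k - 1) * b) - (γ u - 1) * (1 - k) * b)
        * (b * (1 - b) / deriv γ u)) :
    ∀ u ∈ Icc (0 : ℝ) 1,
      (k < c u ∧ c u < 1) ∧
      (deriv c u = -k * (1 - k) * deriv γ u / (γ u + k - 1) ^ 2 ∧ 0 < deriv c u) ∧
      (F u (c u) = 2 * deriv c u ∧ deriv c u < 2 * deriv c u ∧ 0 < deriv c u) := by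
  obtain ⟨hk0, hk1⟩ := hk
  intro u hu
  have hg := hγ u hu
  have hd := hγ' u hu
  have hs : 0 < k + γ u - 1 := by linarith
  have hγd : HasDerivAt γ (deriv γ u) u :=
    (differentiableAt_of_deriv_ne_zero hd.ne).hasDerivAt
  have hcd : deriv c u = -k * (1 - k) * deriv γ u / (γ u + k - 1) ^ 2 := by
    have h := (hγd.const_mul k).fun_div ((hγd.const_add k).sub_const 1) hs.ne'
    rw [funext hc, h.deriv, add_comm (γ u) k]
    congr 1
    ring
  have hpos : 0 < deriv c u := by
    rw [hcd]
    have hs' : 0 < γ u + k - 1 := by linarith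
    refine div_pos ?_ (by positivity)
    nlinarith [mul_pos (mul_pos hk0 (sub_pos.2 hk1)) (neg_pos.2 hd)]
  have hck : c u - k = k * (1 - k) / (k + γ u - 1) := by
    rw [hc]
    field_simp
    ring
  have hc1 : 1 - c u = (1 - k) * (γ u - 1) / (k + γ u - 1) := by
    rw [hc]
    field_simp
    ring
  have h1k : 0 < 1 - k := sub_pos.2 hk1
  have hg1 : 0 < γ u - 1 := sub_pos.2 hg
  have hlt : k < c u := sub_pos.1 (hck ▸ by positivity)
  have hlt1 : c u < 1 := sub_pos.1 (hc1 ▸ by positivity)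
  refine ⟨⟨hlt, hlt1⟩, ⟨hcd, hpos⟩, ?_, by linarith, hpos⟩
  have hzero : γ u * k - (γ u + k - 1) * c u = 0 := by
    rw [hc]
    field_simp
    ring
  have hc0 : c u ≠ 0 := (hk0.trans hlt).ne'
  rw [hF, hzero, hck, hc1, hcd, add_comm (γ u) k, mul_zero, zero_mul, add_zero, zero_sub]
  have hd0 := hd.ne
  field_simp
end

section
/- Fix k ∈ (0,1) and let γ : [0,1] → ℝ be twice continuously differentiable with γ(u) > 1 and γ'(u) < 0 for all u ∈ [0,1]. Let c(u) := kγ(u)/(k+γ(u)−1), H(u,π) := 2(π−k)γ'(u)² + (γ(u)k − (γ(u)+k−1)π)γ''(u), and F(u,b) := ([2(b−k)γ'(u)² + (γ(u)k−(γ(u)+k−1)b)γ''(u)] / [−γ(u)(γ(u)k−(γ(u)+k−1)b) − (γ(u)−1)(1−k)b]) · b(1−b)/γ'(u). Then: (i) for each fixed u, π ↦ H(u,π) is affine with H(u, c(u)) = 2(c(u)−k)γ'(u)² > 0; and (ii) for every (u,b) with 0 < b ≤ c(u), the sign of F(u,b) coincides with the sign of H(u,b), i.e. F(u,b) > 0 ⇔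 H(u,b) > 0, F(u,b) = 0 ⇔ H(u,b) = 0, and F(u,b) < 0 ⇔ H(u,b) < 0. -/
open Set

/-- For each `u`, `π ↦ H(u,π)` is affine with `H(u,c(u)) = 2(c(u)−k)γ'(u)² > 0`,
and on `0 < b ≤ c(u)` the sign of `F(u,b)` coincides with the sign of `H(u,b)`. -/
theorem statement5
    (k : ℝ) (hk : k ∈ Ioo (0 : ℝ) 1)
    (γ : ℝ → ℝ) (hγC : ContDiffOn ℝ 2 γ (Icc 0 1))
    (hγ : ∀ u ∈ Icc (0 : ℝ) 1, 1 < γ u)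
    (hγ' : ∀ u ∈ Icc (0 : ℝ) 1, deriv γ u < 0)
    (c : ℝ → ℝ) (hc : ∀ u, c u = k * γ u / (k + γ u - 1))
    (H : ℝ → ℝ → ℝ)
    (hH : ∀ u π, H u π = 2 * (π - k) * (deriv γ u) ^ 2
      + (γ u * k - (γ u + k - 1) * π) * deriv (deriv γ) u)
    (F : ℝ → ℝ → ℝ)
    (hF : ∀ u b, F u b =
      (2 * (b - k) * (deriv γ u) ^ 2
          + (γ u * k - (γ u + k - 1) * b) * deriv (deriv γ) u) /
        (-(γ u) * (γ u * k - (γ u + k - 1) * b) - (γ u - 1) * (1 - k) * b)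
        * (b * (1 - b) / deriv γ u)) :
    (∀ u ∈ Icc (0 : ℝ) 1,
      (∃ m q : ℝ, ∀ π : ℝ, H u π = m * π + q) ∧
      H u (c u) = 2 * (c u - k) * (deriv γ u) ^ 2 ∧ 0 < H u (c u)) ∧
    (∀ u ∈ Icc (0 : ℝ) 1, ∀ b : ℝ, 0 < b → b ≤ c u →
      ((0 < F u b ↔ 0 < H u b) ∧ (F u b = 0 ↔ H u b = 0) ∧
        (F u b < 0 ↔ H u b < 0))) := by
  obtain ⟨hk0, hk1⟩ := hk
  have c_mul : ∀ u ∈ Icc (0 : ℝ) 1, (γ u + k - 1) * c u = γ u * k := by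
    intro u hu
    have hpos : k + γ u - 1 ≠ 0 := by linarith [hγ u hu]
    rw [hc]
    field_simp
    ring
  refine ⟨fun u hu => ?_, fun u hu b hb0 hbc => ?_⟩
  · have hH_c : H u (c u) = 2 * (c u - k) * (deriv γ u) ^ 2 := by
      rw [hH, c_mul u hu]
      ring
    have hkc : k < c u := by
      have hg := hγ u hu
      rw [hc, lt_div_iff₀ (by linarith)]
      exact mul_lt_mul_of_pos_left (by linarith) hk0
    refine ⟨⟨2 * (deriv γ u) ^ 2 - (γ u + k - 1) * deriv (deriv γ) u,
      γ u * k * deriv (deriv γ) u - 2 * k * (deriv γ u) ^ 2, fun π => ?_⟩, hH_c, ?_⟩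
    · rw [hH]
      ring
    · rw [hH_c]
      exact mul_pos (by linarith) (sq_pos_of_neg (hγ' u hu))
  · have hg := hγ u hu
    have hc1 : c u < 1 := by
      rw [hc, div_lt_one (by linarith)]
      nlinarith
    have hgap : 0 ≤ γ u * k - (γ u + k - 1) * b := by
      rw [← c_mul u hu]
      exact sub_nonneg.2 (mul_le_mul_of_nonneg_left hbc (by linarith))
    have hden : -(γ u) * (γ u * k - (γ u + k - 1) * b) - (γ u - 1) * (1 - k) * b < 0 := by
      have h₁ := mul_nonneg (by linarith : 0 ≤ γ u) hgap
      have h₂ : 0 < (γ u - 1) * (1 - k) * b :=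
        mul_pos (mul_pos (by linarith) (by linarith)) hb0
      linarith
    have hquot : b * (1 - b) / deriv γ u < 0 :=
      div_neg_of_pos_of_neg (mul_pos hb0 (by linarith)) (hγ' u hu)
    obtain ⟨P, hP, hFP⟩ : ∃ P : ℝ, 0 < P ∧ F u b = H u b * P :=
      ⟨_, mul_pos_of_neg_of_neg (inv_lt_zero.2 hden) hquot, by
        rw [hF, hH, div_eq_mul_inv, mul_assoc]⟩
    rw [hFP]
    exact ⟨mul_pos_iff_of_pos_right hP, mul_eq_zero_iff_right hP.ne',
      ⟨fun h => (neg_iff_pos_of_mul_neg h).2 hP, fun h => mul_neg_of_neg_of_pos h hP⟩⟩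
end

section
/- Fix k ∈ (0,1) and let γ : [0,1] → ℝ be twice continuously differentiable with γ(u) > 1 and γ'(u) < 0 for all u ∈ [0,1]. Assume that 2γ'(u)² − γ(u)γ''(u) ≤ 0 for every u ∈ [0,1]. Then the unique solution b of the terminal value problem b'(u) = F(u,b(u)), b(1) = c(1) (which satisfies 0 < b(u) < c(u) for u ∈ [0,1)) is strictly increasing: b'(u) > 0 for all u ∈ [0,1]. -/
open Set

/-- Positivity of the right-hand side of the boundary equation, with `g`, `p`, `q` standing for the
values of `γ`, `γ'`, `γ''` and `x` for a point of `(0, c]`. -/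
theorem boundary_rhs_pos {k g p q x : ℝ} (hk0 : 0 < k) (hk1 : k < 1) (hg : 1 < g) (hp : p < 0)
    (hq : 2 * p ^ 2 - g * q ≤ 0) (hx : 0 < x) (hxc : x ≤ k * g / (k + g - 1)) :
    0 < (2 * (x - k) * p ^ 2 + (g * k - (g + k - 1) * x) * q) /
        (-g * (g * k - (g + k - 1) * x) - (g - 1) * (1 - k) * x) * (x * (1 - x) / p) := by
  have hs : 0 < k + g - 1 := by linarith
  have hg0 : 0 < g := by linarith
  have hgk : 0 < (g - 1) * (1 - k) := mul_pos (by linarith) (by linarith)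
  have hx1 : x < 1 := by
    refine hxc.trans_lt ((div_lt_one hs).2 ?_)
    nlinarith
  have hD : 0 ≤ g * k - (g + k - 1) * x := by
    rw [le_div_iff₀ hs] at hxc
    linarith
  have hnum : 0 < 2 * (x - k) * p ^ 2 + (g * k - (g + k - 1) * x) * q := by
    have hpos : 0 < 2 * p ^ 2 * ((1 - k) * x) :=
      mul_pos (mul_pos two_pos (sq_pos_of_neg hp)) (mul_pos (by linarith) hx)
    have hDq := mul_nonneg hD (sub_nonneg.2 (sub_nonpos.1 hq))
    refine pos_of_mul_pos_right (a := g) ?_ hg0.le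
    linarith
  have hden : -g * (g * k - (g + k - 1) * x) - (g - 1) * (1 - k) * x < 0 := by
    have hgD := mul_nonneg hg0.le hD
    have hgx := mul_pos hgk hx
    linarith
  exact mul_pos_of_neg_of_neg (div_neg_of_pos_of_neg hnum hden)
    (div_neg_of_pos_of_neg (mul_pos hx (by linarith)) hp)

/-- Under the condition `2γ'(u)² − γ(u)γ''(u) ≤ 0`, the solution `b` of the
terminal value problem `b' = F(u,b)`, `b(1) = c(1)` (which satisfies
`0 < b(u) < c(u)` on `[0,1)`) is strictly increasing: `b'(u) > 0` on `[0,1]`. -/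
theorem statement7
    (k : ℝ) (hk : k ∈ Ioo (0 : ℝ) 1)
    (γ : ℝ → ℝ) (hγC : ContDiffOn ℝ 2 γ (Icc 0 1))
    (hγ : ∀ u ∈ Icc (0 : ℝ) 1, 1 < γ u)
    (hγ' : ∀ u ∈ Icc (0 : ℝ) 1, deriv γ u < 0)
    (hcond : ∀ u ∈ Icc (0 : ℝ) 1,
      2 * (deriv γ u) ^ 2 - γ u * deriv (deriv γ) u ≤ 0)
    (c : ℝ → ℝ) (hc : ∀ u, c u = k * γ u / (k + γ u - 1))
    (F : ℝ → ℝ → ℝ)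
    (hF : ∀ u b, F u b =
      (2 * (b - k) * (deriv γ u) ^ 2
          + (γ u * k - (γ u + k - 1) * b) * deriv (deriv γ) u) /
        (-(γ u) * (γ u * k - (γ u + k - 1) * b) - (γ u - 1) * (1 - k) * b)
        * (b * (1 - b) / deriv γ u))
    (b : ℝ → ℝ)
    (hbC : ContDiffOn ℝ 1 b (Icc 0 1))
    (hbode : ∀ u ∈ Icc (0 : ℝ) 1, derivWithin b (Icc 0 1) u = F u (b u))
    (hbterm : b 1 = c 1)
    (hbound : ∀ u ∈ Ico (0 : ℝ) 1, 0 < b u ∧ b u < c u) :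
    ∀ u ∈ Icc (0 : ℝ) 1, 0 < derivWithin b (Icc 0 1) u := by
  intro u hu
  obtain ⟨hk0, hk1⟩ := hk
  have hg := hγ u hu
  have hb : 0 < b u ∧ b u ≤ c u := by
    rcases hu.2.lt_or_eq with h | rfl
    · exact (hbound u ⟨hu.1, h⟩).imp_right le_of_lt
    · rw [hbterm, hc]
      exact ⟨div_pos (mul_pos hk0 (by linarith)) (by linarith), le_rfl⟩
  rw [hbode u hu, hF]
  exact boundary_rhs_pos hk0 hk1 hg (hγ' u hu) (hcond u hu) hb.1 (hc u ▸ hb.2)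
end

section
/- Fix k ∈ (0,1) and let γ : [0,1] → ℝ be twice continuously differentiable with γ(u) > 1 and γ'(u) < 0 for all u ∈ [0,1]. Assume that 2γ'(u)² − γ(u)γ''(u) > 0 for every u ∈ [0,1] and that B'(u) > 0 for every u ∈ [0,1], where B(u) := k·(2γ'(u)² − γ(u)γ''(u)) / (2γ'(u)² − γ(u)γ''(u) + (1−k)γ''(u)). Then the unique solution b of the terminal value problem b'(u) = F(u,b(u)), b(1) = c(1) satisfies b'(u) > 0 and b(u) > B(u) for all u ∈ [0,1]. -/
open Set

/-- If `f` has derivative `f'` within `[a, d]` at `u < d`, vanishes at `u` and is nonnegative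
on `(u, d]`, then `0 ≤ f'`. -/
lemma deriv_nonneg_of_nonneg_right {f : ℝ → ℝ} {f' a d u : ℝ} (hu : u ∈ Ico a d)
    (hf : HasDerivWithinAt f f' (Icc a d) u) (h0 : f u = 0)
    (hpos : ∀ v ∈ Ioc u d, 0 ≤ f v) : 0 ≤ f' := by
  have h1 : HasDerivWithinAt f f' (Ioc u d) u :=
    hf.mono fun v hv => ⟨hu.1.trans hv.1.le, hv.2⟩
  rw [hasDerivWithinAt_iff_tendsto_slope' (by simp)] at h1
  have : (nhdsWithin u (Ioc u d)).NeBot := by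
    rw [nhdsWithin_Ioc_eq_nhdsGT hu.2]
    infer_instance
  refine ge_of_tendsto h1 ?_
  filter_upwards [self_mem_nhdsWithin] with v hv
  rw [slope_def_field, h0, sub_zero]
  exact div_nonneg (hpos v hv) (sub_nonneg.2 hv.1.le)

/-- A function lying above a strictly increasing barrier at the right endpoint, and having zero
derivative wherever it meets the barrier, lies above the barrier everywhere. -/
lemma barrier_lt_of_derivWithin_eq_zero {f g : ℝ → ℝ} {a d : ℝ}
    (hf : DifferentiableOn ℝ f (Icc a d)) (hg : ∀ u ∈ Icc a d, 0 < deriv g u)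
    (hd : g d < f d) (hzero : ∀ u ∈ Icc a d, f u = g u → derivWithin f (Icc a d) u = 0) :
    ∀ u ∈ Icc a d, g u < f u := by
  have hgd : ∀ u ∈ Icc a d, DifferentiableAt ℝ g u := fun u hu =>
    differentiableAt_of_deriv_ne_zero (hg u hu).ne'
  have hcont : ContinuousOn (fun u => f u - g u) (Icc a d) :=
    hf.continuousOn.sub fun u hu => (hgd u hu).continuousAt.continuousWithinAt
  by_contra! hne
  obtain ⟨w, hw, hwle⟩ := hne
  have hcomp : IsCompact (Icc a d ∩ (fun u => f u - g u) ⁻¹' Iic 0) :=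
    isCompact_Icc.of_isClosed_subset
      (hcont.preimage_isClosed_of_isClosed isClosed_Icc isClosed_Iic) inter_subset_left
  obtain ⟨u, ⟨hu, hule⟩, hmax⟩ := hcomp.exists_isGreatest ⟨w, hw, sub_nonpos.2 hwle⟩
  simp only [mem_preimage, mem_Iic] at hule
  have hud : u < d := lt_of_le_of_ne hu.2 (by rintro rfl; linarith)
  have hpos : ∀ v ∈ Ioc u d, 0 ≤ f v - g v := fun v hv => by
    by_contra! h
    exact absurd (hmax ⟨⟨hu.1.trans hv.1.le, hv.2⟩, h.le⟩) (not_le.2 hv.1)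
  have hzero_u : f u - g u = 0 := by
    refine le_antisymm hule ?_
    obtain ⟨v, hv, hv0⟩ := intermediate_value_Icc hud.le
      (hcont.mono (Icc_subset_Icc_left hu.1)) ⟨hule, (sub_pos.2 hd).le⟩
    have hvu : v ≤ u := hmax ⟨⟨hu.1.trans hv.1, hv.2⟩, hv0.le⟩
    rw [← le_antisymm hvu hv.1]
    exact hv0.ge
  have hder := (hf u hu).hasDerivWithinAt.sub (hgd u hu).hasDerivAt.hasDerivWithinAt
  rw [hzero u hu (sub_eq_zero.1 hzero_u)] at hder
  have := deriv_nonneg_of_nonneg_right ⟨hu.1, hud⟩ hder hzero_u hpos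
  linarith [hg u hu]

/-- If `2γ'(u)² − γ(u)γ''(u) > 0` and `B'(u) > 0` on `[0,1]`, then the solution
`b` of the terminal value problem `b' = F(u,b)`, `b(1) = c(1)` satisfies
`b'(u) > 0` and `b(u) > B(u)` on `[0,1]`. -/
theorem statement9
    (k : ℝ) (hk : k ∈ Ioo (0 : ℝ) 1)
    (γ : ℝ → ℝ) (hγC : ContDiffOn ℝ 2 γ (Icc 0 1))
    (hγ : ∀ u ∈ Icc (0 : ℝ) 1, 1 < γ u)
    (hγ' : ∀ u ∈ Icc (0 : ℝ) 1, deriv γ u < 0)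
    (hcond : ∀ u ∈ Icc (0 : ℝ) 1,
      0 < 2 * (deriv γ u) ^ 2 - γ u * deriv (deriv γ) u)
    (B : ℝ → ℝ)
    (hB : ∀ u, B u = k * (2 * (deriv γ u) ^ 2 - γ u * deriv (deriv γ) u) /
      (2 * (deriv γ u) ^ 2 - γ u * deriv (deriv γ) u
        + (1 - k) * deriv (deriv γ) u))
    (hB' : ∀ u ∈ Icc (0 : ℝ) 1, 0 < deriv B u)
    (c : ℝ → ℝ) (hc : ∀ u, c u = k * γ u / (k + γ u - 1))
    (F : ℝ → ℝ → ℝ)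
    (hF : ∀ u b, F u b =
      (2 * (b - k) * (deriv γ u) ^ 2
          + (γ u * k - (γ u + k - 1) * b) * deriv (deriv γ) u) /
        (-(γ u) * (γ u * k - (γ u + k - 1) * b) - (γ u - 1) * (1 - k) * b)
        * (b * (1 - b) / deriv γ u))
    (b : ℝ → ℝ)
    (hbC : ContDiffOn ℝ 1 b (Icc 0 1))
    (hbode : ∀ u ∈ Icc (0 : ℝ) 1, derivWithin b (Icc 0 1) u = F u (b u))
    (hbterm : b 1 = c 1)
    (hbound : ∀ u ∈ Ico (0 : ℝ) 1, 0 < b u ∧ b u < c u) :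
    ∀ u ∈ Icc (0 : ℝ) 1, 0 < derivWithin b (Icc 0 1) u ∧ B u < b u := by
  obtain ⟨hk0, hk1⟩ := hk
  have hgk : ∀ u ∈ Icc (0 : ℝ) 1, 0 < k + γ u - 1 := fun u hu => by linarith [hγ u hu]
  have hD : ∀ u ∈ Icc (0 : ℝ) 1,
      0 < 2 * (deriv γ u) ^ 2 - γ u * deriv (deriv γ) u + (1 - k) * deriv (deriv γ) u := by
    intro u hu
    have hγsq := pow_pos (neg_pos.2 (hγ' u hu)) 2
    rcases le_total 0 (deriv (deriv γ) u) with h | h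
    · linarith [hcond u hu, mul_nonneg (sub_pos.2 hk1).le h]
    · nlinarith [mul_nonneg (hgk u hu).le (neg_nonneg.2 h)]
  have hBc : ∀ u ∈ Icc (0 : ℝ) 1, B u < c u := by
    intro u hu
    rw [hB, hc, div_lt_div_iff₀ (hD u hu) (hgk u hu)]
    have := mul_pos (mul_pos hk0 (sub_pos.2 hk1)) (pow_pos (neg_pos.2 (hγ' u hu)) 2)
    linarith
  have hH : ∀ u ∈ Icc (0 : ℝ) 1, ∀ y,
      2 * (y - k) * (deriv γ u) ^ 2 + (γ u * k - (γ u + k - 1) * y) * deriv (deriv γ) u =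
        (2 * (deriv γ u) ^ 2 - γ u * deriv (deriv γ) u + (1 - k) * deriv (deriv γ) u) *
          (y - B u) := by
    intro u hu y
    rw [hB, mul_sub (_ + _), mul_div_cancel₀ _ (hD u hu).ne']
    ring
  have hb : ∀ u ∈ Icc (0 : ℝ) 1, 0 < b u ∧ b u ≤ c u := by
    intro u hu
    rcases hu.2.lt_or_eq with h | rfl
    · exact ⟨(hbound u ⟨hu.1, h⟩).1, (hbound u ⟨hu.1, h⟩).2.le⟩
    · refine ⟨?_, hbterm.le⟩
      rw [hbterm, hc]
      exact div_pos (mul_pos hk0 (by linarith [hγ 1 hu])) (hgk 1 hu)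
  have hlt : ∀ u ∈ Icc (0 : ℝ) 1, B u < b u := by
    refine barrier_lt_of_derivWithin_eq_zero (hbC.differentiableOn one_ne_zero) hB' ?_ ?_
    · rw [hbterm]
      exact hBc 1 (by simp)
    · intro u hu h
      rw [hbode u hu, hF, hH u hu, h]
      simp
  intro u hu
  refine ⟨?_, hlt u hu⟩
  obtain ⟨hb0, hbc⟩ := hb u hu
  have hg := hγ u hu
  have hprod : 0 < (1 - k) * (γ u - 1) := mul_pos (sub_pos.2 hk1) (sub_pos.2 hg)
  have hc1 : c u < 1 := by
    rw [hc, div_lt_one (hgk u hu)]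
    linarith
  rw [hc, le_div_iff₀ (hgk u hu)] at hbc
  rw [hbode u hu, hF, hH u hu]
  have hnum := mul_pos (hD u hu) (sub_pos.2 (hlt u hu))
  have hden : -(γ u) * (γ u * k - (γ u + k - 1) * b u) - (γ u - 1) * (1 - k) * b u < 0 := by
    have h1 : 0 ≤ γ u * (γ u * k - (γ u + k - 1) * b u) :=
      mul_nonneg (by linarith) (by linarith)
    have h2 := mul_pos hprod hb0
    linarith
  exact mul_pos_of_neg_of_neg (div_neg_of_pos_of_neg hnum hden)
    (div_neg_of_pos_of_neg (mul_pos hb0 (by linarith [(hb u hu).2])) (hγ' u hu))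
end

section
/- Fix k ∈ (0,1) and let γ : [0,1] → ℝ be twice continuously differentiable with γ(u) > 1, γ'(u) < 0 and γ''(u) < 0 for all u ∈ [0,1] (so γ is concave). Assume in addition that B'(u) > 0 for all u ∈ [0,1], where B(u) := k·(2γ'(u)² − γ(u)γ''(u)) / (2γ'(u)² − γ(u)γ''(u) + (1−k)γ''(u)). Then B(u) > k for every u ∈ [0,1], and the unique solution b of the terminal value problem b'(u) = F(u,b(u)), b(1) = c(1) satisfies b'(u) > 0 and b(u) > k for all u ∈ [0,1]. -/
open Set

/-- If `f` is positive at the right endpoint of `[a, d]` and has negative derivative at each of its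
zeros in `[a, d)`, then `f` is positive on `[a, d]`. -/
lemma pos_of_deriv_neg_at_zeros {a d : ℝ} {f f' : ℝ → ℝ}
    (hf : ∀ u ∈ Icc a d, HasDerivWithinAt f (f' u) (Icc a d) u) (hd : 0 < f d)
    (hzero : ∀ u ∈ Ico a d, f u = 0 → f' u < 0) : ∀ u ∈ Icc a d, 0 < f u := by
  have hcont : ContinuousOn f (Icc a d) := fun u hu => (hf u hu).continuousWithinAt
  by_contra! hcon
  obtain ⟨u, hu, hfu⟩ := hcon
  have hclosed : IsClosed (Icc a d ∩ f ⁻¹' Iic 0) :=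
    hcont.preimage_isClosed_of_isClosed isClosed_Icc isClosed_Iic
  obtain ⟨z, ⟨hz, hfz⟩, hmax⟩ :=
    (isCompact_Icc.of_isClosed_subset hclosed inter_subset_left).exists_isGreatest ⟨u, hu, hfu⟩
  have hfz : f z ≤ 0 := hfz
  have hzd : z < d := lt_of_le_of_ne hz.2 (by rintro rfl; exact absurd hd hfz.not_gt)
  obtain ⟨y, hy, hfy⟩ := intermediate_value_Icc hz.2
    (hcont.mono (Icc_subset_Icc_left hz.1)) ⟨hfz, hd.le⟩
  have hyz : y = z := le_antisymm (hmax ⟨⟨hz.1.trans hy.1, hy.2⟩, hfy.le⟩) hy.1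
  subst hyz
  have hpos : ∀ x ∈ Ioo y d, 0 < f x := fun x hx => by
    by_contra! h
    exact absurd (hmax ⟨⟨hz.1.trans hx.1.le, hx.2.le⟩, h⟩) hx.1.not_ge
  have hderiv : HasDerivWithinAt f (f' y) (Ioo y d) y :=
    (hf y hz).mono fun x hx => ⟨hz.1.trans hx.1.le, hx.2.le⟩
  rw [hasDerivWithinAt_iff_tendsto_slope' (by simp)] at hderiv
  have := left_nhdsWithin_Ioo_neBot hzd
  have hnonneg : 0 ≤ f' y := by
    refine ge_of_tendsto hderiv ?_
    filter_upwards [self_mem_nhdsWithin] with x hx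
    rw [slope_def_field, hfy, sub_zero]
    exact div_nonneg (hpos x hx).le (sub_nonneg.2 hx.1.le)
  exact absurd (hzero y ⟨hz.1, hzd⟩ hfy) hnonneg.not_gt

/-- If `γ` is concave (`γ'' < 0`) and `B' > 0`, then `B(u) > k`, and the
solution `b` of the terminal value problem `b' = F(u,b)`, `b(1) = c(1)`
satisfies `b'(u) > 0` and `b(u) > k` for all `u ∈ [0,1]`. -/
theorem statement10
    (k : ℝ) (hk : k ∈ Ioo (0 : ℝ) 1)
    (γ : ℝ → ℝ) (hγC : ContDiffOn ℝ 2 γ (Icc 0 1))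
    (hγ : ∀ u ∈ Icc (0 : ℝ) 1, 1 < γ u)
    (hγ' : ∀ u ∈ Icc (0 : ℝ) 1, deriv γ u < 0)
    (hγ'' : ∀ u ∈ Icc (0 : ℝ) 1, deriv (deriv γ) u < 0)
    (B : ℝ → ℝ)
    (hB : ∀ u, B u = k * (2 * (deriv γ u) ^ 2 - γ u * deriv (deriv γ) u) /
      (2 * (deriv γ u) ^ 2 - γ u * deriv (deriv γ) u
        + (1 - k) * deriv (deriv γ) u))
    (hB' : ∀ u ∈ Icc (0 : ℝ) 1, 0 < deriv B u)
    (c : ℝ → ℝ) (hc : ∀ u, c u = k * γ u / (k + γ u - 1))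
    (F : ℝ → ℝ → ℝ)
    (hF : ∀ u b, F u b =
      (2 * (b - k) * (deriv γ u) ^ 2
          + (γ u * k - (γ u + k - 1) * b) * deriv (deriv γ) u) /
        (-(γ u) * (γ u * k - (γ u + k - 1) * b) - (γ u - 1) * (1 - k) * b)
        * (b * (1 - b) / deriv γ u))
    (b : ℝ → ℝ)
    (hbC : ContDiffOn ℝ 1 b (Icc 0 1))
    (hbode : ∀ u ∈ Icc (0 : ℝ) 1, derivWithin b (Icc 0 1) u = F u (b u))
    (hbterm : b 1 = c 1)
    (hbound : ∀ u ∈ Ico (0 : ℝ) 1, 0 < b u ∧ b u < c u) :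
    (∀ u ∈ Icc (0 : ℝ) 1, k < B u) ∧
    (∀ u ∈ Icc (0 : ℝ) 1, 0 < derivWithin b (Icc 0 1) u ∧ k < b u) := by
  obtain ⟨hk0, hk1⟩ := hk
  have hden : ∀ u ∈ Icc (0 : ℝ) 1, 0 < 2 * (deriv γ u) ^ 2 - γ u * deriv (deriv γ) u
      + (1 - k) * deriv (deriv γ) u := fun u hu => by
    nlinarith [sq_nonneg (deriv γ u), mul_pos (show 0 < γ u - 1 + k by linarith [hγ u hu])
      (neg_pos.2 (hγ'' u hu))]
  have hkB : ∀ u ∈ Icc (0 : ℝ) 1, k < B u := fun u hu => by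
    rw [hB, lt_div_iff₀ (hden u hu)]
    nlinarith [mul_pos hk0 (mul_pos (sub_pos.2 hk1) (neg_pos.2 (hγ'' u hu)))]
  have hgk : ∀ u ∈ Icc (0 : ℝ) 1, 0 < k + γ u - 1 := fun u hu => by linarith [hγ u hu]
  have hBc : ∀ u ∈ Icc (0 : ℝ) 1, B u < c u := fun u hu => by
    rw [hB, hc, div_lt_div_iff₀ (hden u hu) (hgk u hu)]
    nlinarith [mul_pos (mul_pos hk0 (sub_pos.2 hk1)) (pow_pos (neg_pos.2 (hγ' u hu)) 2)]
  have hc1 : ∀ u ∈ Icc (0 : ℝ) 1, c u < 1 := fun u hu => by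
    rw [hc, div_lt_one (hgk u hu)]
    nlinarith [mul_pos (sub_pos.2 hk1) (sub_pos.2 (hγ u hu))]
  have hbc : ∀ u ∈ Icc (0 : ℝ) 1, b u ≤ c u := fun u hu => by
    rcases hu.2.eq_or_lt with rfl | h
    · exact hbterm.le
    · exact (hbound u ⟨hu.1, h⟩).2.le
  have hnum : ∀ u ∈ Icc (0 : ℝ) 1, 2 * (b u - k) * (deriv γ u) ^ 2
      + (γ u * k - (γ u + k - 1) * b u) * deriv (deriv γ) u
      = (2 * (deriv γ u) ^ 2 - γ u * deriv (deriv γ) u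
        + (1 - k) * deriv (deriv γ) u) * (b u - B u) := fun u hu => by
    have h := (hden u hu).ne'
    rw [hB, mul_sub (_ + _), mul_div_cancel₀ _ h]
    ring
  have hder : ∀ u ∈ Icc (0 : ℝ) 1,
      HasDerivWithinAt (fun x => b x - B x) (F u (b u) - deriv B u) (Icc 0 1) u := fun u hu => by
    rw [← hbode u hu]
    exact ((hbC.differentiableOn one_ne_zero) u hu).hasDerivWithinAt.sub
      (differentiableAt_of_deriv_ne_zero (hB' u hu).ne').hasDerivAt.hasDerivWithinAt
  have hBb : ∀ u ∈ Icc (0 : ℝ) 1, 0 < b u - B u := by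
    refine pos_of_deriv_neg_at_zeros hder ?_ fun u hu h => ?_
    · have h1 : (1 : ℝ) ∈ Icc (0 : ℝ) 1 := right_mem_Icc.2 zero_le_one
      rw [hbterm]
      exact sub_pos.2 (hBc 1 h1)
    · have hu' := Ico_subset_Icc_self hu
      rw [hF, hnum u hu', h]
      simpa using hB' u hu'
  refine ⟨hkB, fun u hu => ?_⟩
  have hkb : k < b u := (hkB u hu).trans (sub_pos.1 (hBb u hu))
  have hb0 : 0 < b u := hk0.trans hkb
  refine ⟨?_, hkb⟩
  have hcu : 0 ≤ γ u * k - (γ u + k - 1) * b u := by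
    have h := hbc u hu
    rw [hc, le_div_iff₀ (hgk u hu)] at h
    linarith
  rw [hbode u hu, hF, hnum u hu]
  refine mul_pos_of_neg_of_neg (div_neg_of_pos_of_neg (mul_pos (hden u hu) (hBb u hu)) ?_)
    (div_neg_of_pos_of_neg
      (mul_pos hb0 (sub_pos.2 ((hbc u hu).trans_lt (hc1 u hu)))) (hγ' u hu))
  have hg := hγ u hu
  have h1 := mul_nonneg (zero_le_one.trans hg.le) hcu
  have h2 := mul_pos (mul_pos (sub_pos.2 hg) (sub_pos.2 hk1)) hb0
  linarith
end

section
/- Fix k ∈ (0,1) and let γ : [0,1] → ℝ be three times continuously differentiable with γ(u) > 1, γ'(u) < 0 and γ''(u) < 0 for all u ∈ [0,1]. Assume that 3γ''(u)² < 2γ'(u)γ'''(u) for all u ∈ [0,1]. Then the function B(u) := k·(2γ'(u)² − γ(u)γ''(u)) / (2γ'(u)² − γ(u)γ''(u) + (1−k)γ''(u)) is strictly increasing on [0,1], i.e. B'(u) > 0 for all u ∈ [0,1]. -/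
open Set

/-- If `γ ∈ C³` is decreasing and concave with `3γ''² < 2γ'γ'''`, then the
zero-level curve `B` of `H` is strictly increasing: `B'(u) > 0` on `[0,1]`. -/
theorem statement11
    (k : ℝ) (hk : k ∈ Ioo (0 : ℝ) 1)
    (γ : ℝ → ℝ) (hγC : ContDiffOn ℝ 3 γ (Icc 0 1))
    (hγ : ∀ u ∈ Icc (0 : ℝ) 1, 1 < γ u)
    (hγ' : ∀ u ∈ Icc (0 : ℝ) 1, deriv γ u < 0)
    (hγ'' : ∀ u ∈ Icc (0 : ℝ) 1, deriv (deriv γ) u < 0)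
    (hγ''' : ∀ u ∈ Icc (0 : ℝ) 1,
      3 * (deriv (deriv γ) u) ^ 2 < 2 * deriv γ u * deriv (deriv (deriv γ)) u)
    (B : ℝ → ℝ)
    (hB : ∀ u, B u = k * (2 * (deriv γ u) ^ 2 - γ u * deriv (deriv γ) u) /
      (2 * (deriv γ u) ^ 2 - γ u * deriv (deriv γ) u
        + (1 - k) * deriv (deriv γ) u)) :
    ∀ u ∈ Icc (0 : ℝ) 1, 0 < deriv B u := by
  intro u hu
  obtain ⟨hk0, hk1⟩ := hk
  have h0 := hγ u hu
  have h1 := hγ' u hu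
  have h2 := hγ'' u hu
  have h3 := hγ''' u hu
  have d0 : HasDerivAt γ (deriv γ u) u :=
    (differentiableAt_of_deriv_ne_zero h1.ne).hasDerivAt
  have d1 : HasDerivAt (deriv γ) (deriv (deriv γ) u) u :=
    (differentiableAt_of_deriv_ne_zero h2.ne).hasDerivAt
  have h3_ne : deriv (deriv (deriv γ)) u ≠ 0 := by
    intro h
    rw [h] at h3
    nlinarith [sq_nonneg (deriv (deriv γ) u)]
  have d2 : HasDerivAt (deriv (deriv γ)) (deriv (deriv (deriv γ)) u) u :=
    (differentiableAt_of_deriv_ne_zero h3_ne).hasDerivAt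
  have hD : 0 < 2 * (deriv γ u) ^ 2 - γ u * deriv (deriv γ) u
      + (1 - k) * deriv (deriv γ) u := by
    nlinarith [sq_nonneg (deriv γ u), mul_pos (neg_pos.2 h2) (by linarith : 0 < γ u - 1 + k)]
  have dN := ((d1.fun_pow 2).const_mul 2).fun_sub (d0.fun_mul d2)
  have dB := (dN.const_mul k).fun_div (dN.fun_add (d2.const_mul (1 - k))) hD.ne'
  rw [funext hB, dB.deriv]
  refine div_pos ?_ (pow_pos hD 2)
  have key : 0 < k * (1 - k) * (-deriv γ u *
      (2 * deriv γ u * deriv (deriv (deriv γ)) u - 3 * (deriv (deriv γ) u) ^ 2)) :=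
    mul_pos (mul_pos hk0 (sub_pos.2 hk1)) (mul_pos (neg_pos.2 h1) (sub_pos.2 h3))
  refine key.trans_eq ?_
  push_cast
  ring
end

section
/- Fix k ∈ (0,1) and let γ : [0,1] → ℝ be twice continuously differentiable with γ(u) > 1 and γ'(u) < 0 for all u ∈ [0,1], and assume the condition 2γ'(u)² − γ(u)γ''(u) ≤ 0 holds for every u ∈ [0,1]. Fix u₀ ∈ [0,1], write γ₀ := γ(u₀), γ'₀ := γ'(u₀), and let π ∈ (0,1) satisfy π ≤ c(u₀) := kγ₀/(k+γ₀−1). Then for every u ∈ [0, u₀], ((γ₀² − γ₀)/(γ(u)² − γ(u)) − 1)·(γ₀ k − (γ₀ + k − 1)π)/(−γ'₀) + (π − k)(u − u₀) ≤ 0. -/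
open Set

/-- If `2 (γ')² ≤ γ γ''`, then `1 / γ` is concave. -/
lemma concaveOn_inv_of_two_mul_sq_deriv_le {γ : ℝ → ℝ} {s : Set ℝ} (hs : Convex ℝ s)
    (hγC : ContDiffOn ℝ 2 γ s) (hγ : ∀ u ∈ s, 0 < γ u)
    (hcond : ∀ u ∈ interior s, 2 * (deriv γ u) ^ 2 - γ u * deriv (deriv γ) u ≤ 0) :
    ConcaveOn ℝ s (fun u => (γ u)⁻¹) := by
  have hne : ∀ u ∈ s, γ u ≠ 0 := fun u hu => (hγ u hu).ne'
  have hint : ContDiffOn ℝ 2 γ (interior s) := hγC.mono interior_subset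
  have h1 : ∀ u ∈ interior s, HasDerivAt γ (deriv γ u) u := fun u hu =>
    ((hint.differentiableOn (by norm_num)).differentiableAt
      (isOpen_interior.mem_nhds hu)).hasDerivAt
  have h2 : ∀ u ∈ interior s, HasDerivAt (deriv γ) (deriv (deriv γ) u) u := fun u hu =>
    (((hint.deriv_of_isOpen (m := 1) isOpen_interior (by norm_num)).differentiableOn
      (by norm_num)).differentiableAt (isOpen_interior.mem_nhds hu)).hasDerivAt
  refine concaveOn_of_hasDerivWithinAt2_nonpos (f' := fun u => -deriv γ u / γ u ^ 2)
    (f'' := fun u => (2 * (deriv γ u) ^ 2 - γ u * deriv (deriv γ) u) / γ u ^ 3) hs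
    (hγC.continuousOn.inv₀ hne) (fun u hu => ?_) (fun u hu => ?_) (fun u hu => ?_)
  · exact ((h1 u hu).inv (hne u (interior_subset hu))).hasDerivWithinAt
  · have hu0 := hne u (interior_subset hu)
    refine (((h2 u hu).neg.div ((h1 u hu).pow 2) (pow_ne_zero 2 hu0)).congr_deriv
      ?_).hasDerivWithinAt
    simp only [Pi.neg_apply, Pi.pow_apply]
    field_simp
    ring
  · exact div_nonpos_of_nonpos_of_nonneg (hcond u hu) (pow_pos (hγ u (interior_subset hu)) 3).le

/-- The algebraic core of the estimate: `g`, `g₀` are the values of the exponent at two points at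
distance `s`, and `h` is the tangent line inequality for its reciprocal. -/
lemma sq_sub_ratio_estimate {k p g g₀ d s : ℝ} (hk : k < 1) (hp : 0 < p) (hg : 1 < g)
    (hg₀ : 1 < g₀) (hd : 0 < d) (hs : 0 ≤ s)
    (hA : 0 ≤ g₀ * k - (g₀ + k - 1) * p) (h : s * d * g ≤ g₀ * (g - g₀)) :
    ((g₀ ^ 2 - g₀) / (g ^ 2 - g) - 1) * ((g₀ * k - (g₀ + k - 1) * p) / d) + (k - p) * s ≤ 0 := by
  have hgg : 0 ≤ g - g₀ := by
    have : 0 ≤ g₀ * (g - g₀) := le_trans (by positivity) h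
    exact nonneg_of_mul_nonneg_right this (by linarith)
  have hg1 : 0 < g - 1 := by linarith
  have hden : 0 < g ^ 2 - g := by nlinarith
  set A := g₀ * k - (g₀ + k - 1) * p with hAdef
  have hratio : (g₀ ^ 2 - g₀) / (g ^ 2 - g) - 1 ≤ -((g - g₀) / g) := by
    rw [← sub_nonneg]
    have : -((g - g₀) / g) - ((g₀ ^ 2 - g₀) / (g ^ 2 - g) - 1)
        = (g - g₀) * g₀ / (g * (g - 1)) := by
      rw [show g ^ 2 - g = g * (g - 1) by ring]
      field_simp
      ring
    rw [this]
    positivity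
  have hfirst := mul_le_mul_of_nonneg_right hratio (div_nonneg hA hd.le)
  have hsecond : (k - p) * s ≤ (g - g₀) / g * (A / d) := by
    rw [div_mul_div_comm, le_div_iff₀ (by positivity)]
    rcases le_total k p with hkp | hkp
    · have : (k - p) * (s * (g * d)) ≤ 0 :=
        mul_nonpos_of_nonpos_of_nonneg (by linarith) (by positivity)
      nlinarith [mul_nonneg hgg hA]
    · have h1 := mul_le_mul_of_nonneg_left h (sub_nonneg.2 hkp)
      have h2 : 0 ≤ (g - g₀) * ((1 - k) * p) :=
        mul_nonneg hgg (mul_nonneg (by linarith) hp.le)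
      rw [hAdef]
      nlinarith
  linarith

/-- The key estimate for the verification: under `2γ'² − γγ'' ≤ 0`, for
`π ≤ c(u₀)` and `u ≤ u₀`,
`((γ₀²−γ₀)/(γ(u)²−γ(u)) − 1)(γ₀k − (γ₀+k−1)π)/(−γ'₀) + (π−k)(u−u₀) ≤ 0`. -/
theorem statement12
    (k : ℝ) (hk : k ∈ Ioo (0 : ℝ) 1)
    (γ : ℝ → ℝ) (hγC : ContDiffOn ℝ 2 γ (Icc 0 1))
    (hγ : ∀ u ∈ Icc (0 : ℝ) 1, 1 < γ u)
    (hγ' : ∀ u ∈ Icc (0 : ℝ) 1, deriv γ u < 0)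
    (hcond : ∀ u ∈ Icc (0 : ℝ) 1,
      2 * (deriv γ u) ^ 2 - γ u * deriv (deriv γ) u ≤ 0)
    (u₀ : ℝ) (hu₀ : u₀ ∈ Icc (0 : ℝ) 1)
    (π : ℝ) (hπ : π ∈ Ioo (0 : ℝ) 1)
    (hπc : π ≤ k * γ u₀ / (k + γ u₀ - 1)) :
    ∀ u ∈ Icc (0 : ℝ) u₀,
      ((γ u₀ ^ 2 - γ u₀) / (γ u ^ 2 - γ u) - 1)
          * ((γ u₀ * k - (γ u₀ + k - 1) * π) / (-(deriv γ u₀)))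
        + (π - k) * (u - u₀) ≤ 0 := by
  intro u hu
  have huI : u ∈ Icc (0 : ℝ) 1 := ⟨hu.1, hu.2.trans hu₀.2⟩
  rcases hu.2.eq_or_lt with rfl | hlt
  · have : γ u ^ 2 - γ u ≠ 0 := by nlinarith [hγ u huI]
    simp [div_self this]
  have hg := hγ u huI
  have hg₀ := hγ u₀ hu₀
  have hconc := concaveOn_inv_of_two_mul_sq_deriv_le (convex_Icc 0 1) hγC
    (fun v hv => zero_lt_one.trans (hγ v hv)) (fun v hv => hcond v (interior_subset hv))
  have hder : HasDerivAt γ (deriv γ u₀) u₀ :=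
    (differentiableAt_of_deriv_ne_zero (hγ' u₀ hu₀).ne).hasDerivAt
  have hslope := hconc.le_slope_of_hasDerivAt huI hu₀ hlt (hder.inv (by linarith))
  have htangent : (u₀ - u) * -deriv γ u₀ * γ u ≤ γ u₀ * (γ u - γ u₀) := by
    rw [slope_def_field, le_div_iff₀ (sub_pos.2 hlt)] at hslope
    have h := mul_le_mul_of_nonneg_right hslope
      (show 0 ≤ γ u₀ ^ 2 * γ u by positivity)
    have hne : γ u ≠ 0 := by linarith
    have hne₀ : γ u₀ ≠ 0 := by linarith
    field_simp at h
    linarith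
  have hA : 0 ≤ γ u₀ * k - (γ u₀ + k - 1) * π := by
    rw [le_div_iff₀ (by linarith [hk.1])] at hπc
    linarith
  have := sq_sub_ratio_estimate hk.2 hπ.1 hg hg₀ (neg_pos.2 (hγ' u₀ hu₀))
    (sub_pos.2 hlt).le hA htangent
  linarith
end

section
/- In the setting of the candidate value function V̂ built from a strictly increasing solution b of the boundary ODE (k ∈ (0,1); γ : [0,1] → (1,∞) twice continuously differentiable with γ' < 0; b' = F(u,b), b(1) = c(1), 0 < b(u) < c(u), b' > 0; h the extended inverse of b; G(u,π) = (1−π)(π/(1−π))^{γ(u)}; A(u) = ((γ(u)+k−1)b(u) − γ(u)k)/(γ'(u)G(u,b(u))); V̂(u,π) = A(u)G(u,π) for π ≤ b(u) and V̂(u,π) = A(h(π))G(h(π),π) + (π−k)(h(π)−u) for π > b(u)), assume additionally that either b(u) ≥ k for every u ∈ [0,1], or 2γ'(u)² − γ(u)γ''(u) ≤ 0 for every u ∈ [0,1]. Then for every (u,π) ∈ [0,1]×(0,1) with π ≠ b(u), π²(1−π)²·V̂_ππ(u,π) ≤ (γ(u)² − γ(u))·V̂(u,π); equivalently, with ρ(u)²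 = 2r/(γ(u)²−γ(u)), (ρ(u)²/2)π²(1−π)²V̂_ππ(u,π) − rV̂(u,π) ≤ 0, with equality for π < b(u). -/
open Set

open Filter Topology

/-- A function that is affine to the right of `a` has vanishing iterated derivative on `[a, ∞)`. -/
lemma deriv_deriv_eq_zero_of_affine_right {f : ℝ → ℝ} {a m c x : ℝ}
    (hf : ∀ p, a < p → f p = m * p + c) (hx : a ≤ x) : deriv (deriv f) x = 0 := by
  have hd : ∀ p, a < p → deriv f p = m := by
    intro p hp
    have h1 : f =ᶠ[𝓝 p] fun p => m * p + c := by
      filter_upwards [Ioi_mem_nhds hp] with q hq using hf q hq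
    rw [h1.deriv_eq]
    simp
  by_cases hdiff : DifferentiableAt ℝ (deriv f) x
  · have hev : ∀ᶠ q in 𝓝[>] x, deriv f q = m := by
      filter_upwards [self_mem_nhdsWithin] with q hq using hd q (lt_of_le_of_lt hx hq)
    have hval : deriv f x = m := by
      have h1 : Tendsto (deriv f) (𝓝[>] x) (𝓝 (deriv f x)) :=
        hdiff.continuousAt.tendsto.mono_left nhdsWithin_le_nhds
      have h2 : Tendsto (deriv f) (𝓝[>] x) (𝓝 m) :=
        tendsto_const_nhds.congr' (hev.mono fun _ hq => hq.symm)
      exact tendsto_nhds_unique h1 h2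
    have h3 : HasDerivWithinAt (deriv f) 0 (Ioi x) x :=
      (hasDerivWithinAt_const x (Ioi x) m).congr_of_eventuallyEq hev hval
    exact (uniqueDiffWithinAt_Ioi x).eq_deriv _ hdiff.hasDerivAt.hasDerivWithinAt h3
  · exact deriv_zero_of_not_differentiableAt hdiff

lemma hasDerivAt_log_odds {p : ℝ} (hp : p ∈ Ioo (0 : ℝ) 1) :
    HasDerivAt (fun p : ℝ => Real.log (p / (1 - p))) (1 / (p * (1 - p))) p := by
  have h0 : p ≠ 0 := hp.1.ne'
  have h1 : 1 - p ≠ 0 := (sub_pos.2 hp.2).ne'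
  have := ((hasDerivAt_id p).div ((hasDerivAt_id p).const_sub 1) h1).log (div_ne_zero h0 h1)
  refine this.congr_deriv ?_
  simp only [id, Pi.div_apply]
  field_simp
  ring

lemma one_sub_mul_rpow_odds {p : ℝ} (hp : p ∈ Ioo (0 : ℝ) 1) (g : ℝ) :
    (1 - p) * (p / (1 - p)) ^ g = (1 - p) * Real.exp (g * Real.log (p / (1 - p))) := by
  rw [Real.rpow_def_of_pos (div_pos hp.1 (sub_pos.2 hp.2)), mul_comm g]

/-- First derivative of the value along a moving coefficient `α`, exponent `β` and level `τ`
satisfying the value-matching condition. -/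
lemma hasDerivAt_value {α β τ : ℝ → ℝ} {k u p α' β' τ' : ℝ} (hp : p ∈ Ioo (0 : ℝ) 1)
    (hα : HasDerivAt α α' p) (hβ : HasDerivAt β β' p) (hτ : HasDerivAt τ τ' p)
    (h1 : α' * ((1 - p) * Real.exp (β p * Real.log (p / (1 - p))))
      + α p * β' * Real.log (p / (1 - p)) *
        ((1 - p) * Real.exp (β p * Real.log (p / (1 - p)))) + (p - k) * τ' = 0) :
    HasDerivAt (fun p => α p * ((1 - p) * Real.exp (β p * Real.log (p / (1 - p))))
        + (p - k) * (τ p - u))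
      (α p * Real.exp (β p * Real.log (p / (1 - p))) * (β p - p) / p + (τ p - u)) p := by
  have h0 : p ≠ 0 := hp.1.ne'
  have h1' : 1 - p ≠ 0 := (sub_pos.2 hp.2).ne'
  have hE := (hβ.mul (hasDerivAt_log_odds hp)).exp
  have := (hα.mul (((hasDerivAt_id p).const_sub 1).mul hE)).add
    (((hasDerivAt_id p).sub_const k).mul (hτ.sub_const u))
  refine this.congr_deriv ?_
  simp only [id, Pi.mul_apply]
  generalize Real.exp (β p * Real.log (p / (1 - p))) = E at *
  generalize Real.log (p / (1 - p)) = L at *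
  field_simp
  linear_combination p * h1

/-- Derivative of the slope of the value when both value matching and smooth fit hold. -/
lemma hasDerivAt_slope_value {α β τ : ℝ → ℝ} {k u p α' β' τ' : ℝ} (hp : p ∈ Ioo (0 : ℝ) 1)
    (hα : HasDerivAt α α' p) (hβ : HasDerivAt β β' p) (hτ : HasDerivAt τ τ' p)
    (h1 : α' * ((1 - p) * Real.exp (β p * Real.log (p / (1 - p))))
      + α p * β' * Real.log (p / (1 - p)) *
        ((1 - p) * Real.exp (β p * Real.log (p / (1 - p)))) + (p - k) * τ' = 0)
    (h2 : α p * β' * ((1 - p) * Real.exp (β p * Real.log (p / (1 - p))))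
      = τ' * ((β p + k - 1) * p - β p * k)) :
    HasDerivAt (fun p => α p * Real.exp (β p * Real.log (p / (1 - p))) * (β p - p) / p
        + (τ p - u))
      (α p * Real.exp (β p * Real.log (p / (1 - p))) * (β p ^ 2 - β p) / (p ^ 2 * (1 - p))) p := by
  have h0 : p ≠ 0 := hp.1.ne'
  have h1' : 1 - p ≠ 0 := (sub_pos.2 hp.2).ne'
  have hE := (hβ.mul (hasDerivAt_log_odds hp)).exp
  have := (((hα.mul hE).mul (hβ.sub (hasDerivAt_id p))).div (hasDerivAt_id p) h0).add
    (hτ.sub_const u)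
  refine this.congr_deriv ?_
  simp only [id, Pi.mul_apply, Pi.sub_apply]
  generalize Real.exp (β p * Real.log (p / (1 - p))) = E at *
  generalize Real.log (p / (1 - p)) = L at *
  field_simp
  linear_combination (p * (β p - p)) * h1 + p * h2

/-- The second derivative identity on an open set on which value matching and smooth fit hold. -/
lemma deriv_deriv_value {S : Set ℝ} (hS : IsOpen S) (hS1 : S ⊆ Ioo (0 : ℝ) 1)
    {f α β τ : ℝ → ℝ} {k u : ℝ}
    (hf : ∀ p ∈ S, f p = α p * ((1 - p) * (p / (1 - p)) ^ β p) + (p - k) * (τ p - u))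
    (hfit : ∀ p ∈ S, ∃ α' β' τ', HasDerivAt α α' p ∧ HasDerivAt β β' p ∧ HasDerivAt τ τ' p ∧
      α' * ((1 - p) * (p / (1 - p)) ^ β p)
        + α p * β' * Real.log (p / (1 - p)) * ((1 - p) * (p / (1 - p)) ^ β p)
        + (p - k) * τ' = 0 ∧
      α p * β' * ((1 - p) * (p / (1 - p)) ^ β p) = τ' * ((β p + k - 1) * p - β p * k))
    {p : ℝ} (hp : p ∈ S) :
    p ^ 2 * (1 - p) ^ 2 * deriv (deriv f) p
      = (β p ^ 2 - β p) * (α p * ((1 - p) * (p / (1 - p)) ^ β p)) := by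
  have hd : ∀ q ∈ S, deriv f q
      = α q * Real.exp (β q * Real.log (q / (1 - q))) * (β q - q) / q + (τ q - u) := by
    intro q hq
    obtain ⟨α', β', τ', hα, hβ, hτ, h1, -⟩ := hfit q hq
    rw [one_sub_mul_rpow_odds (hS1 hq)] at h1
    have he : f =ᶠ[𝓝 q] fun p => α p * ((1 - p) * Real.exp (β p * Real.log (p / (1 - p))))
        + (p - k) * (τ p - u) := by
      filter_upwards [hS.mem_nhds hq] with s hs
      rw [hf s hs, one_sub_mul_rpow_odds (hS1 hs)]
    rw [he.deriv_eq]
    exact (hasDerivAt_value (hS1 hq) hα hβ hτ h1).deriv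
  obtain ⟨α', β', τ', hα, hβ, hτ, h1, h2⟩ := hfit p hp
  rw [one_sub_mul_rpow_odds (hS1 hp)] at h1 h2 ⊢
  have he : deriv f =ᶠ[𝓝 p] fun q =>
      α q * Real.exp (β q * Real.log (q / (1 - q))) * (β q - q) / q + (τ q - u) := by
    filter_upwards [hS.mem_nhds hp] with q hq using hd q hq
  rw [he.deriv_eq, (hasDerivAt_slope_value (hS1 hp) hα hβ hτ h1 h2).deriv]
  have h0 : p ≠ 0 := (hS1 hp).1.ne'
  have h1' : 1 - p ≠ 0 := (sub_pos.2 (hS1 hp).2).ne'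
  field_simp

/-- Tangent-line inequality for `1 / γ`, which is concave when `2γ'² - γγ'' ≤ 0`. -/
lemma sq_le_mul_tangent {γ : ℝ → ℝ} (hγC : ContinuousOn γ (Icc 0 1))
    (hγ : ∀ u ∈ Icc (0 : ℝ) 1, 0 < γ u)
    (hγ1 : ∀ v ∈ Ioo (0 : ℝ) 1, HasDerivAt γ (deriv γ v) v)
    (hγ2 : ∀ v ∈ Ioo (0 : ℝ) 1, HasDerivAt (deriv γ) (deriv (deriv γ) v) v)
    (hle : ∀ u ∈ Icc (0 : ℝ) 1, 2 * (deriv γ u) ^ 2 - γ u * deriv (deriv γ) u ≤ 0)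
    {u v : ℝ} (hu : 0 ≤ u) (huv : u < v) (hv : v < 1) :
    γ v ^ 2 ≤ γ u * (γ v + deriv γ v * (v - u)) := by
  have hI : ∀ x ∈ Ioo (0 : ℝ) 1, x ∈ Icc (0 : ℝ) 1 := fun x hx => Ioo_subset_Icc_self hx
  have h1 : ∀ x ∈ Ioo (0 : ℝ) 1,
      HasDerivAt (fun x => (γ x)⁻¹) (-deriv γ x / γ x ^ 2) x := fun x hx =>
    (hγ1 x hx).fun_inv (hγ x (hI x hx)).ne'
  have hconc : ConcaveOn ℝ (Icc (0 : ℝ) 1) (fun x => (γ x)⁻¹) := by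
    apply concaveOn_of_hasDerivWithinAt2_nonpos (convex_Icc 0 1)
      (f' := fun x => -deriv γ x / γ x ^ 2)
      (f'' := fun x => (2 * (deriv γ x) ^ 2 - γ x * deriv (deriv γ) x) / γ x ^ 3)
    · exact hγC.inv₀ fun x hx => (hγ x hx).ne'
    · rw [interior_Icc]
      exact fun x hx => (h1 x hx).hasDerivWithinAt
    · rw [interior_Icc]
      intro x hx
      have hx0 := (hγ x (hI x hx)).ne'
      have := (hγ2 x hx).neg.div ((hγ1 x hx).pow 2) (pow_ne_zero 2 hx0)
      refine (this.congr_deriv ?_).hasDerivWithinAt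
      simp only [Pi.neg_apply, Pi.pow_apply]
      field_simp
      ring
    · rw [interior_Icc]
      intro x hx
      exact div_nonpos_of_nonpos_of_nonneg (hle x (hI x hx)) (pow_pos (hγ x (hI x hx)) 3).le
  have hvI : v ∈ Ioo (0 : ℝ) 1 := ⟨hu.trans_lt huv, hv⟩
  have huI : u ∈ Icc (0 : ℝ) 1 := ⟨hu, (huv.trans hv).le⟩
  have hs := hconc.le_slope_of_hasDerivAt huI (hI v hvI) huv (h1 v hvI)
  rw [slope_def_field, le_div_iff₀ (sub_pos.2 huv)] at hs
  have gu := hγ u huI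
  have gv := hγ v (hI v hvI)
  have hm := mul_le_mul_of_nonneg_left hs (by positivity : 0 ≤ γ u * γ v ^ 2)
  have e1 : γ u * γ v ^ 2 * (-deriv γ v / γ v ^ 2 * (v - u)) = -(γ u * deriv γ v * (v - u)) := by
    field_simp
  have e2 : γ u * γ v ^ 2 * ((γ v)⁻¹ - (γ u)⁻¹) = γ u * γ v - γ v ^ 2 := by
    field_simp
  rw [e1, e2] at hm
  linarith

/-- The derivative of the coefficient `A` along a solution of the boundary equation satisfies
value matching. -/
lemma exists_hasDerivAt_coefficient {k v b' γ₁ γ₂ : ℝ} {γ γd b A : ℝ → ℝ}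
    (hγ : HasDerivAt γ γ₁ v) (hγd : HasDerivAt γd γ₂ v) (hγ₁ : γd v = γ₁) (hγ₁0 : γ₁ ≠ 0)
    (hb : HasDerivAt b b' v) (hbv : b v ∈ Ioo (0 : ℝ) 1)
    (hA : A =ᶠ[𝓝 v] fun u => ((γ u + k - 1) * b u - γ u * k) /
      (γd u * ((1 - b u) * (b u / (1 - b u)) ^ γ u)))
    (hD : -(γ v) * (γ v * k - (γ v + k - 1) * b v) - (γ v - 1) * (1 - k) * b v ≠ 0)
    (hode : b' = (2 * (b v - k) * γ₁ ^ 2 + (γ v * k - (γ v + k - 1) * b v) * γ₂) /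
        (-(γ v) * (γ v * k - (γ v + k - 1) * b v) - (γ v - 1) * (1 - k) * b v)
        * (b v * (1 - b v) / γ₁)) :
    ∃ a, HasDerivAt A a v ∧
      a * ((1 - b v) * (b v / (1 - b v)) ^ γ v)
        + A v * γ₁ * Real.log (b v / (1 - b v)) * ((1 - b v) * (b v / (1 - b v)) ^ γ v)
        + (b v - k) = 0 := by
  have h0 : b v ≠ 0 := hbv.1.ne'
  have h1 : 1 - b v ≠ 0 := (sub_pos.2 hbv.2).ne'
  have hA' : A =ᶠ[𝓝 v] fun u => ((γ u + k - 1) * b u - γ u * k) /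
      (γd u * ((1 - b u) * Real.exp (γ u * Real.log (b u / (1 - b u))))) := by
    filter_upwards [hA, hb.continuousAt.eventually_mem (Ioo_mem_nhds hbv.1 hbv.2)] with u hu hbu
    rw [hu, one_sub_mul_rpow_odds hbu]
  have hE := (hγ.mul ((hasDerivAt_log_odds hbv).comp v hb)).exp
  have hden := hγd.mul ((hb.const_sub 1).mul hE)
  have hnum := (((hγ.add_const k).sub_const 1).mul hb).sub (hγ.mul_const k)
  have hden0 : (γd * ((fun x => 1 - b x) * fun x => Real.exp ((γ * ((fun p : ℝ =>
      Real.log (p / (1 - p))) ∘ b)) x))) v ≠ 0 := by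
    simp only [Pi.mul_apply, hγ₁]
    exact mul_ne_zero hγ₁0 (mul_ne_zero h1 (Real.exp_pos _).ne')
  have hdiv := (hnum.div hden hden0).congr_of_eventuallyEq (f₁ := A) hA'
  refine ⟨_, hdiv, ?_⟩
  rw [hA'.eq_of_nhds, one_sub_mul_rpow_odds hbv]
  simp only [Pi.mul_apply, Pi.sub_apply, Function.comp, hγ₁]
  have hEp := (Real.exp_pos (γ v * Real.log (b v / (1 - b v)))).ne'
  generalize Real.exp (γ v * Real.log (b v / (1 - b v))) = E at *
  generalize Real.log (b v / (1 - b v)) = L at *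
  generalize hDd : -(γ v) * (γ v * k - (γ v + k - 1) * b v) - (γ v - 1) * (1 - k) * b v = D at *
  have hode' : b' * D * γ₁ = (2 * (b v - k) * γ₁ ^ 2
      + (γ v * k - (γ v + k - 1) * b v) * γ₂) * (b v * (1 - b v)) := by
    rw [hode]; field_simp
  clear hode hdiv hnum hden hden0 hE hA hA'
  generalize b v = B at *
  generalize γ v = g at *
  subst hDd
  field_simp
  linear_combination (-1 : ℝ) * hode'

/-- A left inverse of an increasing function with nonvanishing derivative is differentiable. -/
lemma hasDerivAt_leftInverse {b h : ℝ → ℝ} {u w v b' : ℝ} (hbc : ContinuousOn b (Icc u w))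
    (hmono : StrictMonoOn b (Icc u w)) (hinv : ∀ x ∈ Icc u w, h (b x) = x)
    (hv : v ∈ Ioo u w) (hb : HasDerivAt b b' v) (hb0 : b' ≠ 0) :
    HasDerivAt h b'⁻¹ (b v) := by
  have huw : u ≤ w := (hv.1.trans hv.2).le
  have huI : u ∈ Icc u w := left_mem_Icc.2 huw
  have hwI : w ∈ Icc u w := right_mem_Icc.2 huw
  have hvI : v ∈ Icc u w := Ioo_subset_Icc_self hv
  have hsurj : ∀ p ∈ Ioo (b u) (b w), ∃ x ∈ Ioo u w, b x = p :=
    fun p hp => intermediate_value_Ioo huw hbc hp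
  have hnhds : Ioo (b u) (b w) ∈ 𝓝 (b v) :=
    Ioo_mem_nhds (hmono huI hvI hv.1) (hmono hvI hwI hv.2)
  have hhv : h (b v) = v := hinv v hvI
  have hcont : ContinuousAt h (b v) := by
    apply StrictMonoOn.continuousAt_of_image_mem_nhds (s := Ioo (b u) (b w)) ?_ hnhds ?_
    · intro p hp q hq hpq
      obtain ⟨x, hx, rfl⟩ := hsurj p hp
      obtain ⟨y, hy, rfl⟩ := hsurj q hq
      rw [hinv x (Ioo_subset_Icc_self hx), hinv y (Ioo_subset_Icc_self hy)]
      exact (hmono.lt_iff_lt (Ioo_subset_Icc_self hx) (Ioo_subset_Icc_self hy)).1 hpq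
    · rw [hhv]
      filter_upwards [Ioo_mem_nhds hv.1 hv.2] with x hx
      have hxI := Ioo_subset_Icc_self hx
      exact ⟨b x, ⟨hmono huI hxI hx.1, hmono hxI hwI hx.2⟩, hinv x hxI⟩
  refine HasDerivAt.of_local_left_inverse hcont (by rwa [hhv]) hb0 ?_
  filter_upwards [hnhds] with p hp
  obtain ⟨x, hx, rfl⟩ := hsurj p hp
  rw [hinv x (Ioo_subset_Icc_self hx)]

/-- Algebraic form of the variational inequality above the boundary, for exponents `g` at the
current level and `m < g` at the target level. -/
lemma mul_le_mul_of_tangent {k p g m m' W d : ℝ} (hk : k ≤ 1) (hp : 0 ≤ p) (hm : 1 < m)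
    (hmg : m ≤ g) (hd : 0 ≤ d) (hW : W * m' = (m + k - 1) * p - m * k)
    (hW0 : 0 ≤ W) (h : k ≤ p ∨ m ^ 2 ≤ g * (m + m' * d)) :
    (m ^ 2 - m) * W ≤ (g ^ 2 - g) * (W + (p - k) * d) := by
  have hg : 1 < g := hm.trans_le hmg
  have hgg : 0 ≤ g ^ 2 - g := by nlinarith
  have hq : m ^ 2 - m ≤ g ^ 2 - g := by nlinarith
  rcases h with h | h
  · have h1 := mul_le_mul_of_nonneg_right hq hW0
    have h2 := mul_nonneg hgg (mul_nonneg (sub_nonneg.2 h) hd)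
    linarith
  · have h1 : (m ^ 2 - m) * W ≤ (g - 1) * m * W :=
      mul_le_mul_of_nonneg_right (by nlinarith) hW0
    have h2 : 0 ≤ (g - 1) * W / m * (g * (m + m' * d) - m ^ 2) :=
      mul_nonneg (div_nonneg (mul_nonneg (by linarith) hW0) (by linarith)) (sub_nonneg.2 h)
    have h3 : (g - 1) * W / m * (g * (m + m' * d) - m ^ 2)
        = (g ^ 2 - g) * (W + (W * m') * d / m) - (g - 1) * m * W := by
      field_simp
    have h4 : 0 ≤ (g ^ 2 - g) * ((1 - k) * p * d / m) :=
      mul_nonneg hgg (div_nonneg (mul_nonneg (mul_nonneg (sub_nonneg.2 hk) hp) hd) (by linarith))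
    have h5 : (g ^ 2 - g) * (W + (W * m') * d / m) + (g ^ 2 - g) * ((1 - k) * p * d / m)
        = (g ^ 2 - g) * (W + (p - k) * d) := by
      rw [hW]
      field_simp
      ring
    linarith

/-- Under the additional assumption that `b(u) ≥ k` for every `u`, or that
`2γ'² − γγ'' ≤ 0`, the candidate value function `V̂` satisfies the variational
inequality `π²(1−π)² V̂_ππ ≤ (γ² − γ) V̂` for `π ≠ b(u)`, with equality below the
boundary. -/
theorem statement15
    (k : ℝ) (hk : k ∈ Ioo (0 : ℝ) 1)
    (γ : ℝ → ℝ) (hγC : ContDiffOn ℝ 2 γ (Icc 0 1))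
    (hγ : ∀ u ∈ Icc (0 : ℝ) 1, 1 < γ u)
    (hγ' : ∀ u ∈ Icc (0 : ℝ) 1, deriv γ u < 0)
    (c : ℝ → ℝ) (hc : ∀ u, c u = k * γ u / (k + γ u - 1))
    (F : ℝ → ℝ → ℝ)
    (hF : ∀ u b, F u b =
      (2 * (b - k) * (deriv γ u) ^ 2
          + (γ u * k - (γ u + k - 1) * b) * deriv (deriv γ) u) /
        (-(γ u) * (γ u * k - (γ u + k - 1) * b) - (γ u - 1) * (1 - k) * b)
        * (b * (1 - b) / deriv γ u))
    (b : ℝ → ℝ)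
    (hbC : ContDiffOn ℝ 1 b (Icc 0 1))
    (hbode : ∀ u ∈ Icc (0 : ℝ) 1, derivWithin b (Icc 0 1) u = F u (b u))
    (hbterm : b 1 = c 1)
    (hbound : ∀ u ∈ Ico (0 : ℝ) 1, 0 < b u ∧ b u < c u)
    (hbmono : ∀ u ∈ Icc (0 : ℝ) 1, 0 < derivWithin b (Icc 0 1) u)
    (h : ℝ → ℝ)
    (hinv : ∀ u ∈ Icc (0 : ℝ) 1, h (b u) = u)
    (hext1 : ∀ π : ℝ, b 1 < π → h π = 1)
    (hext0 : ∀ π : ℝ, π < b 0 → h π = 0)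
    (G : ℝ → ℝ → ℝ)
    (hG : ∀ u π : ℝ, G u π = (1 - π) * (π / (1 - π)) ^ γ u)
    (A : ℝ → ℝ)
    (hA : ∀ u, A u = ((γ u + k - 1) * b u - γ u * k) / (deriv γ u * G u (b u)))
    (V : ℝ → ℝ → ℝ)
    (hV1 : ∀ u π : ℝ, π ≤ b u → V u π = A u * G u π)
    (hV2 : ∀ u π : ℝ, b u < π →
      V u π = A (h π) * G (h π) π + (π - k) * (h π - u))
    (hassump : (∀ u ∈ Icc (0 : ℝ) 1, k ≤ b u) ∨
      (∀ u ∈ Icc (0 : ℝ) 1, 2 * (deriv γ u) ^ 2 - γ u * deriv (deriv γ) u ≤ 0)) :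
    ∀ u ∈ Icc (0 : ℝ) 1, ∀ π ∈ Ioo (0 : ℝ) 1,
      (π ≠ b u →
        π ^ 2 * (1 - π) ^ 2 * deriv (deriv (fun p => V u p)) π
          ≤ (γ u ^ 2 - γ u) * V u π) ∧
      (π < b u →
        π ^ 2 * (1 - π) ^ 2 * deriv (deriv (fun p => V u p)) π
          = (γ u ^ 2 - γ u) * V u π) := by
  have hk0 := hk.1
  have hk1 := hk.2
  have h0I : (0 : ℝ) ∈ Icc (0 : ℝ) 1 := by simp
  have h1I : (1 : ℝ) ∈ Icc (0 : ℝ) 1 := by simp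
  have hI : ∀ x ∈ Ioo (0 : ℝ) 1, x ∈ Icc (0 : ℝ) 1 := fun x hx => Ioo_subset_Icc_self hx
  have hγ1 : ∀ v ∈ Icc (0 : ℝ) 1, HasDerivAt γ (deriv γ v) v := fun v hv =>
    (differentiableAt_of_deriv_ne_zero (hγ' v hv).ne).hasDerivAt
  have hγ2 : ∀ v ∈ Ioo (0 : ℝ) 1, HasDerivAt (deriv γ) (deriv (deriv γ) v) v := by
    intro v hv
    have h1 : ContDiffOn ℝ 1 (deriv γ) (Ioo 0 1) :=
      (hγC.mono Ioo_subset_Icc_self).deriv_of_isOpen isOpen_Ioo (by norm_num)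
    exact ((h1.differentiableOn one_ne_zero).differentiableAt
      (Ioo_mem_nhds hv.1 hv.2)).hasDerivAt
  have hγanti : StrictAntiOn γ (Icc 0 1) := by
    apply strictAntiOn_of_deriv_neg (convex_Icc 0 1) hγC.continuousOn
    intro x hx
    exact hγ' x (interior_subset hx)
  have hbc : ContinuousOn b (Icc 0 1) := hbC.continuousOn
  have hb1 : ∀ v ∈ Ioo (0 : ℝ) 1, HasDerivAt b (derivWithin b (Icc 0 1) v) v := fun v hv =>
    (hbC.differentiableOn one_ne_zero v (hI v hv)).hasDerivWithinAt.hasDerivAt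
      (Icc_mem_nhds hv.1 hv.2)
  have hmono : StrictMonoOn b (Icc 0 1) := by
    apply strictMonoOn_of_deriv_pos (convex_Icc 0 1) hbc
    intro x hx
    rw [interior_Icc] at hx
    rw [(hb1 x hx).deriv]
    exact hbmono x (hI x hx)
  have hden : ∀ u ∈ Icc (0 : ℝ) 1, 0 < k + γ u - 1 := fun u hu => by linarith [hγ u hu]
  have hcpos : ∀ u ∈ Icc (0 : ℝ) 1, 0 < c u := fun u hu => by
    rw [hc]
    exact div_pos (mul_pos hk0 (by linarith [hγ u hu])) (hden u hu)
  have hc1 : ∀ u ∈ Icc (0 : ℝ) 1, c u < 1 := fun u hu => by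
    rw [hc, div_lt_one (hden u hu)]
    nlinarith [mul_pos (sub_pos.2 hk1) (sub_pos.2 (hγ u hu))]
  have hbI : ∀ u ∈ Icc (0 : ℝ) 1, 0 < b u ∧ b u ≤ c u := by
    intro u hu
    rcases hu.2.eq_or_lt with rfl | hlt
    · exact ⟨hbterm ▸ hcpos 1 hu, hbterm.le⟩
    · exact ⟨(hbound u ⟨hu.1, hlt⟩).1, (hbound u ⟨hu.1, hlt⟩).2.le⟩
  have hb01 : ∀ u ∈ Icc (0 : ℝ) 1, b u ∈ Ioo (0 : ℝ) 1 := fun u hu =>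
    ⟨(hbI u hu).1, (hbI u hu).2.trans_lt (hc1 u hu)⟩
  have hN : ∀ u ∈ Icc (0 : ℝ) 1, (γ u + k - 1) * b u - γ u * k ≤ 0 := by
    intro u hu
    have h1 := (hbI u hu).2
    rw [hc, le_div_iff₀ (hden u hu)] at h1
    linarith
  have hD : ∀ u ∈ Icc (0 : ℝ) 1,
      -(γ u) * (γ u * k - (γ u + k - 1) * b u) - (γ u - 1) * (1 - k) * b u < 0 := by
    intro u hu
    have h1 := hγ u hu
    have h2 := mul_pos (mul_pos (sub_pos.2 h1) (sub_pos.2 hk1)) (hbI u hu).1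
    nlinarith [hN u hu]
  have hGpos : ∀ u, ∀ p ∈ Ioo (0 : ℝ) 1, 0 < (1 - p) * (p / (1 - p)) ^ γ u := fun u p hp =>
    mul_pos (sub_pos.2 hp.2) (Real.rpow_pos_of_pos (div_pos hp.1 (sub_pos.2 hp.2)) _)
  have hAG : ∀ u ∈ Icc (0 : ℝ) 1,
      A u * ((1 - b u) * (b u / (1 - b u)) ^ γ u) * deriv γ u
        = (γ u + k - 1) * b u - γ u * k := by
    intro u hu
    have h1 := (hGpos u (b u) (hb01 u hu)).ne'
    have h2 := (hγ' u hu).ne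
    rw [hA, hG]
    generalize (1 - b u) * (b u / (1 - b u)) ^ γ u = g at *
    field_simp
  have hA1 : A 1 = 0 := by
    have h1 : (γ 1 + k - 1) * b 1 - γ 1 * k = 0 := by
      have h2 := (hden 1 h1I).ne'
      rw [hbterm, hc]
      field_simp
      ring
    rw [hA, h1, zero_div]
  intro u hu π hπ
  have hlow : π < b u → π ^ 2 * (1 - π) ^ 2 * deriv (deriv (fun p => V u p)) π
      = (γ u ^ 2 - γ u) * V u π := by
    intro hlt
    rw [deriv_deriv_value (S := Ioo 0 (b u)) isOpen_Ioo
      (Ioo_subset_Ioo_right (hb01 u hu).2.le) (α := fun _ => A u) (β := fun _ => γ u)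
      (τ := fun _ => u) (k := k) (u := u) ?_ ?_ ⟨hπ.1, hlt⟩, hV1 u π hlt.le, hG]
    · intro p hp
      rw [hV1 u p hp.2.le, hG]
      ring
    · intro p _
      refine ⟨0, 0, 0, hasDerivAt_const _ _, hasDerivAt_const _ _, hasDerivAt_const _ _, ?_, ?_⟩
        <;> ring
  refine ⟨fun hne => ?_, hlow⟩
  rcases lt_or_gt_of_ne hne with hlt | hgt
  · exact (hlow hlt).le
  rcases le_or_gt (b 1) π with hge | hlt1
  · have hh : ∀ p, b 1 ≤ p → h p = 1 := by
      intro p hp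
      rcases hp.eq_or_lt with rfl | hp
      · exact hinv 1 h1I
      · exact hext1 p hp
    have hub1 : b u ≤ b 1 := hmono.monotoneOn hu h1I hu.2
    have h0 : deriv (deriv (fun p => V u p)) π = 0 := by
      refine deriv_deriv_eq_zero_of_affine_right (a := b 1) (m := 1 - u) (c := -k * (1 - u))
        (fun p hp => ?_) hge
      rw [hV2 u p (hub1.trans_lt hp), hh p hp.le, hA1]
      ring
    have hkb : k ≤ b 1 := by
      rw [hbterm, hc, le_div_iff₀ (hden 1 h1I)]
      nlinarith
    rw [h0, hV2 u π hgt, hh π hge, hA1, mul_zero, zero_mul, zero_add]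
    exact mul_nonneg (by nlinarith [hγ u hu])
      (mul_nonneg (by linarith) (by linarith [hu.2]))
  · have hsub : Icc u 1 ⊆ Icc (0 : ℝ) 1 := Icc_subset_Icc_left hu.1
    have hsurj : ∀ p ∈ Ioo (b u) (b 1), ∃ x ∈ Ioo u 1, b x = p :=
      fun p hp => intermediate_value_Ioo hu.2 (hbc.mono hsub) hp
    have hdd := deriv_deriv_value (S := Ioo (b u) (b 1)) isOpen_Ioo
      (Ioo_subset_Ioo (hbI u hu).1.le (hb01 1 h1I).2.le) (f := fun p => V u p)
      (α := fun p => A (h p)) (β := fun p => γ (h p)) (τ := h) (k := k) (u := u)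
      (fun p hp => by simp only [hV2 u p hp.1, hG]) ?_ ⟨hgt, hlt1⟩
    · obtain ⟨v, hv, rfl⟩ := hsurj π ⟨hgt, hlt1⟩
      have hvI : v ∈ Ioo (0 : ℝ) 1 := ⟨hu.1.trans_lt hv.1, hv.2⟩
      have hvC := hI v hvI
      simp only [hV2 u (b v) hgt, hG, hinv v hvC] at hdd ⊢
      rw [hdd]
      have hW := hAG v hvC
      refine mul_le_mul_of_tangent hk1.le hπ.1.le (hγ v hvC) (hγanti hu hvC hv.1).le
        (sub_nonneg.2 hv.1.le) hW ?_ ?_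
      · by_contra! hneg
        have := mul_pos_of_neg_of_neg hneg (hγ' v hvC)
        linarith [hN v hvC]
      · refine hassump.imp (fun ha => ha v hvC) fun ha => ?_
        exact sq_le_mul_tangent hγC.continuousOn (fun x hx => by linarith [hγ x hx])
          (fun x hx => hγ1 x (hI x hx)) hγ2 ha hu.1 hv.1 hv.2
    · intro p hp
      obtain ⟨v, hv, rfl⟩ := hsurj p hp
      have hvI : v ∈ Ioo (0 : ℝ) 1 := ⟨hu.1.trans_lt hv.1, hv.2⟩
      have hvC := hI v hvI
      have hhv := hinv v hvC
      have hb' := hbmono v hvC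
      have hh := hasDerivAt_leftInverse (hbc.mono hsub) (hmono.mono hsub)
        (fun x hx => hinv x (hsub hx)) hv (hb1 v hvI) hb'.ne'
      obtain ⟨a, ha, hvm⟩ := exists_hasDerivAt_coefficient (k := k) (A := A) (hγ1 v hvC)
        (hγ2 v hvI) rfl (hγ' v hvC).ne (hb1 v hvI) (hb01 v hvC)
        (Eventually.of_forall fun x => by simp only [hA, hG]) (hD v hvC).ne
        (by rw [hbode v hvC, hF])
      have ha' : HasDerivAt A a (h (b v)) := by rwa [hhv]
      have hg' : HasDerivAt γ (deriv γ v) (h (b v)) := by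
        rw [hhv]
        exact hγ1 v hvC
      refine ⟨_, _, _, ha'.comp (b v) hh, hg'.comp (b v) hh, hh, ?_, ?_⟩
      · simp only [hhv]
        linear_combination (derivWithin b (Icc 0 1) v)⁻¹ * hvm
      · simp only [hhv]
        linear_combination (derivWithin b (Icc 0 1) v)⁻¹ * hAG v hvC
end

section
/- Let r > 0 and C > 0, and for u ∈ (0,1] define γ(u) := 1/2 + √(1/4 + 2r/(C²u)) (the case of signal-to-noise ratio ρ(u) = C√u). Then γ is twice continuously differentiable on (0,1] with γ(u) > 1 and γ'(u) < 0, and the condition 2γ'(u)² − γ(u)γ''(u) ≤ 0 holds for every u ∈ (0,1]. -/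
open Set

lemma hasDerivAt_quarter_add_div (a : ℝ) {u : ℝ} (hu : 0 < u) :
    HasDerivAt (fun v : ℝ => 1 / 4 + a / v) (-a / u ^ 2) u := by
  simpa using ((hasDerivAt_const u a).div (hasDerivAt_id u) hu.ne').const_add (1 / 4)

lemma hasDerivAt_half_add_sqrt {a u : ℝ} (ha : 0 < a) (hu : 0 < u) :
    HasDerivAt (fun v : ℝ => 1 / 2 + Real.sqrt (1 / 4 + a / v))
      (-a / u ^ 2 / (2 * Real.sqrt (1 / 4 + a / u))) u :=
  ((hasDerivAt_quarter_add_div a hu).sqrt (by positivity)).const_add (1 / 2)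

lemma hasDerivAt_deriv_half_add_sqrt {a u : ℝ} (ha : 0 < a) (hu : 0 < u) :
    HasDerivAt (deriv fun v : ℝ => 1 / 2 + Real.sqrt (1 / 4 + a / v))
      (a / (u ^ 3 * Real.sqrt (1 / 4 + a / u)) -
        a ^ 2 / (4 * u ^ 4 * Real.sqrt (1 / 4 + a / u) ^ 3)) u := by
  have hs : 0 < Real.sqrt (1 / 4 + a / u) := Real.sqrt_pos.2 (by positivity)
  have hden := ((hasDerivAt_quarter_add_div a hu).sqrt (by positivity)).const_mul 2
  have hnum := (hasDerivAt_const u (-a)).div (hasDerivAt_pow 2 u) (by positivity)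
  refine ((hnum.div hden (by positivity)).congr_of_eventuallyEq ?_).congr_deriv ?_
  · filter_upwards [lt_mem_nhds hu] with v hv
    exact (hasDerivAt_half_add_sqrt ha hv).deriv
  · simp only [Pi.div_apply]
    generalize Real.sqrt (1 / 4 + a / u) = s at hs
    field_simp
    ring

lemma contDiffOn_half_add_sqrt {a : ℝ} (ha : 0 < a) {n : WithTop ℕ∞} :
    ContDiffOn ℝ n (fun v : ℝ => 1 / 2 + Real.sqrt (1 / 4 + a / v)) (Ioi 0) := by
  refine contDiffOn_const.add (ContDiffOn.sqrt ?_ ?_)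
  · exact contDiffOn_const.add (contDiffOn_const.div contDiffOn_id fun v hv => (ne_of_gt hv))
  · intro v hv
    have : 0 < v := hv
    positivity

/-- Project-expansion example `ρ(u) = C√u`: the exponent
`γ(u) = 1/2 + √(1/4 + 2r/(C²u))` is twice continuously differentiable on
`(0,1]` with `γ(u) > 1`, `γ'(u) < 0`, and `2γ'(u)² − γ(u)γ''(u) ≤ 0`. -/
theorem statement17
    (r C : ℝ) (hr : 0 < r) (hC : 0 < C)
    (γ : ℝ → ℝ)
    (hγ : ∀ u : ℝ, γ u = 1 / 2 + Real.sqrt (1 / 4 + 2 * r / (C ^ 2 * u))) :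
    ContDiffOn ℝ 2 γ (Ioc 0 1) ∧
    ∀ u ∈ Ioc (0 : ℝ) 1,
      1 < γ u ∧
      deriv γ u < 0 ∧
      2 * (deriv γ u) ^ 2 - γ u * deriv (deriv γ) u ≤ 0 := by
  obtain ⟨a, ha⟩ : ∃ a, a = 2 * r / C ^ 2 := ⟨_, rfl⟩
  have ha0 : 0 < a := by rw [ha]; positivity
  obtain rfl : γ = fun v : ℝ => 1 / 2 + Real.sqrt (1 / 4 + a / v) := by
    funext v
    rw [hγ, ha, div_div]
  refine ⟨(contDiffOn_half_add_sqrt ha0).mono Ioc_subset_Ioi_self, fun u hu => ?_⟩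
  have hu0 : 0 < u := hu.1
  have hau : 0 < a / u := by positivity
  rw [(hasDerivAt_deriv_half_add_sqrt ha0 hu0).deriv, (hasDerivAt_half_add_sqrt ha0 hu0).deriv]
  have hsq : Real.sqrt (1 / 4 + a / u) ^ 2 = 1 / 4 + a / u := Real.sq_sqrt (by positivity)
  have hs : 1 / 2 < Real.sqrt (1 / 4 + a / u) := Real.lt_sqrt_of_sq_lt (by linarith)
  beta_reduce
  generalize Real.sqrt (1 / 4 + a / u) = s at hsq hs
  have hs0 : 0 < s := by linarith
  refine ⟨by linarith, ?_, ?_⟩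
  · rw [neg_div, neg_div, neg_lt_zero]
    positivity
  · have hsu : a = u * (s ^ 2 - 1 / 4) := by
      rw [hsq]
      field_simp
      ring
    have key : 2 * (-a / u ^ 2 / (2 * s)) ^ 2 -
        (1 / 2 + s) * (a / (u ^ 3 * s) - a ^ 2 / (4 * u ^ 4 * s ^ 3)) =
        -(a * (s + 1 / 2) ^ 3 / (4 * u ^ 3 * s ^ 3)) := by
      rw [hsu]
      field_simp
      ring
    rw [key, neg_nonpos]
    positivity
end

section
/- Let k ∈ (0,1) and let γ₀ > γ₁ > 1 be real numbers. Set c₀ := kγ₀/(k+γ₀−1), so k < c₀ < 1. Let V : [0,1] → ℝ be continuous and convex with V(0) = 0 and V(c₀) > 0, and define f(b) := (γ₀ + k − 1)b − γ₀k + (γ₀ − γ₁)V(b) for b ∈ [0,1]. Then f is convex, f(0) = −γ₀k < 0, f(c₀) = (γ₀ − γ₁)V(c₀) > 0, and there exists a unique b* ∈ (0, c₀) with f(b*) = 0. -/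
open Set

/-- A convex function that is negative at `a` and nonpositive at `y` is negative in between. -/
theorem ConvexOn.neg_of_neg_of_nonpos {s : Set ℝ} {f : ℝ → ℝ} (hf : ConvexOn ℝ s f)
    {a x y : ℝ} (ha : a ∈ s) (hy : y ∈ s) (hax : a < x) (hxy : x < y)
    (hfa : f a < 0) (hfy : f y ≤ 0) : f x < 0 := by
  have hslope := hf.slope_mono_adjacent ha hy hax hxy
  rw [div_le_div_iff₀ (by linarith) (by linarith)] at hslope
  by_contra! hfx
  have h₁ : 0 < (f x - f a) * (y - x) := mul_pos (by linarith) (by linarith)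
  have h₂ : (f y - f x) * (x - a) ≤ 0 :=
    mul_nonpos_of_nonpos_of_nonneg (by linarith) (by linarith)
  linarith

/-- Discrete problem: with `γ₀ > γ₁ > 1`, `c₀ = kγ₀/(k+γ₀−1) ∈ (k,1)`, and a
continuous convex continuation value `V` with `V(0) = 0` and `V(c₀) > 0`, the
function `f(b) = (γ₀+k−1)b − γ₀k + (γ₀−γ₁)V(b)` is convex, negative at `0`,
positive at `c₀`, and has a unique zero `b* ∈ (0,c₀)`. -/
theorem statement18
    (k γ₀ γ₁ : ℝ) (hk : k ∈ Ioo (0 : ℝ) 1)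
    (hγ₁ : 1 < γ₁) (hγ₀₁ : γ₁ < γ₀)
    (c₀ : ℝ) (hc₀ : c₀ = k * γ₀ / (k + γ₀ - 1))
    (V : ℝ → ℝ)
    (hVcont : ContinuousOn V (Icc 0 1))
    (hVconv : ConvexOn ℝ (Icc 0 1) V)
    (hV0 : V 0 = 0) (hVc : 0 < V c₀)
    (f : ℝ → ℝ)
    (hf : ∀ b, f b = (γ₀ + k - 1) * b - γ₀ * k + (γ₀ - γ₁) * V b) :
    (k < c₀ ∧ c₀ < 1) ∧
    ConvexOn ℝ (Icc 0 1) f ∧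
    (f 0 = -(γ₀ * k) ∧ f 0 < 0) ∧
    (f c₀ = (γ₀ - γ₁) * V c₀ ∧ 0 < f c₀) ∧
    (∃! bstar, bstar ∈ Ioo 0 c₀ ∧ f bstar = 0) := by
  obtain ⟨hk0, hk1⟩ := hk
  have hden : 0 < k + γ₀ - 1 := by linarith
  have hkc : k < c₀ := by
    rw [hc₀, lt_div_iff₀ hden]
    nlinarith
  have hc1 : c₀ < 1 := by
    rw [hc₀, div_lt_one hden]
    nlinarith
  have hmem : ∀ b ∈ Icc 0 c₀, b ∈ Icc (0 : ℝ) 1 := fun b hb => ⟨hb.1, hb.2.trans hc1.le⟩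
  have hf_eq : f = fun b => (γ₀ + k - 1) * b - γ₀ * k + (γ₀ - γ₁) * V b := funext hf
  have hconv : ConvexOn ℝ (Icc 0 1) f := by
    refine ⟨convex_Icc 0 1, fun x hx y hy a b ha hb hab => ?_⟩
    have hV := mul_le_mul_of_nonneg_left (hVconv.2 hx hy ha hb hab) (sub_pos.2 hγ₀₁).le
    simp only [hf, smul_eq_mul] at hV ⊢
    linear_combination hV + γ₀ * k * hab
  have hcont : ContinuousOn f (Icc 0 c₀) := by
    have hV := hVcont.mono hmem
    rw [hf_eq]
    fun_prop
  have hf0 : f 0 = -(γ₀ * k) := by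
    rw [hf, hV0]
    ring
  have hf0_neg : f 0 < 0 := by
    rw [hf0]
    exact neg_neg_of_pos (mul_pos (by linarith) hk0)
  have hfc : f c₀ = (γ₀ - γ₁) * V c₀ := by
    have hc : c₀ * (k + γ₀ - 1) = k * γ₀ := by
      rw [hc₀, div_mul_cancel₀ _ hden.ne']
    rw [hf]
    linear_combination hc
  have hfc_pos : 0 < f c₀ := by
    rw [hfc]
    exact mul_pos (sub_pos.2 hγ₀₁) hVc
  have hneg : ∀ x y, x ∈ Ioo 0 c₀ → y ∈ Ioo 0 c₀ → f y = 0 → x < y → f x < 0 :=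
    fun x y hx hy hfy hxy =>
      hconv.neg_of_neg_of_nonpos ⟨le_rfl, zero_le_one⟩ (hmem y (Ioo_subset_Icc_self hy))
        hx.1 hxy hf0_neg hfy.le
  obtain ⟨b, hb, hfb⟩ := intermediate_value_Ioo (hk0.trans hkc).le hcont ⟨hf0_neg, hfc_pos⟩
  refine ⟨⟨hkc, hc1⟩, hconv, ⟨hf0, hf0_neg⟩, ⟨hfc, hfc_pos⟩, b, ⟨hb, hfb⟩, ?_⟩
  rintro y ⟨hy, hfy⟩
  rcases lt_trichotomy y b with h | h | h
  · exact absurd hfy (hneg y b hy hb hfb h).ne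
  · exact h
  · exact absurd hfb (hneg b y hb hy hfy h).ne
end

section
/- Let k ∈ (0,1) and let γ₀ > γ₁ > γ₂ > 1 be real numbers satisfying 2(γ₀ − γ₁)(γ₁ − γ₂) − (γ₀ − 2γ₁ + γ₂)γ₁ ≤ 0. Set c₁ := kγ₁/(k+γ₁−1) and define the affine function H(b) := 2(b−k)(γ₀ − γ₁) + (γ₁k − (γ₁+k−1)b)(γ₀ − 2γ₁ + γ₂)/(γ₁ − γ₂). Then H(0) ≥ 0 and H(c₁) = 2(c₁ − k)(γ₀ − γ₁) > 0, and consequently H(b) > 0 for every b ∈ (0, c₁]. -/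
open Set

/-- Discrete monotonicity condition: if
`2(γ₀−γ₁)(γ₁−γ₂) − (γ₀−2γ₁+γ₂)γ₁ ≤ 0`, then the affine function
`H(b) = 2(b−k)(γ₀−γ₁) + (γ₁k − (γ₁+k−1)b)(γ₀−2γ₁+γ₂)/(γ₁−γ₂)` satisfies
`H(0) ≥ 0`, `H(c₁) = 2(c₁−k)(γ₀−γ₁) > 0`, and `H(b) > 0` on `(0,c₁]`. -/
theorem statement19
    (k γ₀ γ₁ γ₂ : ℝ) (hk : k ∈ Ioo (0 : ℝ) 1)
    (hγ₂ : 1 < γ₂) (hγ₁₂ : γ₂ < γ₁) (hγ₀₁ : γ₁ < γ₀)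
    (hcond : 2 * (γ₀ - γ₁) * (γ₁ - γ₂) - (γ₀ - 2 * γ₁ + γ₂) * γ₁ ≤ 0)
    (c₁ : ℝ) (hc₁ : c₁ = k * γ₁ / (k + γ₁ - 1))
    (H : ℝ → ℝ)
    (hH : ∀ b, H b = 2 * (b - k) * (γ₀ - γ₁)
      + (γ₁ * k - (γ₁ + k - 1) * b) * (γ₀ - 2 * γ₁ + γ₂) / (γ₁ - γ₂)) :
    0 ≤ H 0 ∧
    (H c₁ = 2 * (c₁ - k) * (γ₀ - γ₁) ∧ 0 < H c₁) ∧
    (∀ b : ℝ, 0 < b → b ≤ c₁ → 0 < H b) := by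
  obtain ⟨hk0, hk1⟩ := hk
  have hd : 0 < γ₁ - γ₂ := by linarith
  have hs : 0 < k + γ₁ - 1 := by linarith
  have hc₁s : c₁ * (k + γ₁ - 1) = k * γ₁ := by
    rw [hc₁, div_mul_cancel₀ _ hs.ne']
  have hkc : k < c₁ := by
    rw [hc₁, lt_div_iff₀ hs]
    nlinarith
  have hH0 : 0 ≤ H 0 := by
    have h : H 0 = k * -(2 * (γ₀ - γ₁) * (γ₁ - γ₂) - (γ₀ - 2 * γ₁ + γ₂) * γ₁)
        / (γ₁ - γ₂) := by
      rw [hH, eq_div_iff hd.ne', add_mul, div_mul_cancel₀ _ hd.ne']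
      ring
    rw [h]
    exact div_nonneg (mul_nonneg hk0.le (by linarith)) hd.le
  have hHc : H c₁ = 2 * (c₁ - k) * (γ₀ - γ₁) := by
    have h : γ₁ * k - (γ₁ + k - 1) * c₁ = 0 := by linarith
    rw [hH, h]
    simp
  have hHc_pos : 0 < H c₁ := by
    rw [hHc]
    exact mul_pos (by linarith) (by linarith)
  refine ⟨hH0, ⟨hHc, hHc_pos⟩, fun b hb hbc => ?_⟩
  have hconv : c₁ * H b = (c₁ - b) * H 0 + b * H c₁ := by
    rw [hH b, hH 0, hH c₁]
    ring
  have hpos : 0 < c₁ * H b := by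
    rw [hconv]
    exact add_pos_of_nonneg_of_pos (mul_nonneg (by linarith) hH0) (mul_pos hb hHc_pos)
  exact pos_of_mul_pos_right hpos (by linarith)
end
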